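/- arXiv:math/0211103 — 2 statements merged into one kernel-verified Lean document; each statement's English description precedes it below -/
import Mathlib

section
/- Let I ⊆ ℝ be a closed interval and Φ : I → ℝ a C² convex function satisfying (H1). For each i = 1, …, n, let μ_i be a probability measure on ℝ^{d_i} and c_i > 0 be such that for every Lipschitz function g : ℝ^{d_i} → I, Ent_{μ_i}^Φ(g) ≤ c_i · ∫ Φ''(g) · ‖∇g‖² dμ_i. Let Θ_i : ℝ^{d_i} → ℝ be Lipschitz with Lipschitz constant at most √α_i for some α_i > 0, and let μ be the probability measure on ℝ equal to the pushforward of the product measure μ_1 ⊗ ⋯ ⊗ μ_n under the map (x_1, …, x_n) ↦ Θ_1(x_1) + ⋯ + Θ_n(x_n), i.e. μ = (Θ_1·μ_1) * ⋯ * (Θ_n·μ_n). Then for every C¹ function f : ℝ → I with bounded derivative, Ent_μ^Φ(f) ≤ (c_1·α_1 + ⋯ + c_n·α_n) · ∫ Φ''(f) · |f'|² dμ. -/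
open MeasureTheory

open Filter Topology ProbabilityTheory

/-- A consequence of Fatou's lemma: a pointwise limit of nonnegative integrable functions with
bounded integrals is integrable. -/
lemma integrable_of_tendsto_of_integral_le {Ω : Type*} [MeasurableSpace Ω] {μ : Measure Ω}
    {F : ℕ → Ω → ℝ} {f : Ω → ℝ} {C : ℝ} (hF : ∀ n, Integrable (F n) μ)
    (hF0 : ∀ n x, 0 ≤ F n x) (hFC : ∀ n, ∫ x, F n x ∂μ ≤ C)
    (hlim : ∀ x, Tendsto (fun n => F n x) atTop (𝓝 (f x))) : Integrable f μ := by
  have hmeas : AEStronglyMeasurable f μ :=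
    aestronglyMeasurable_of_tendsto_ae atTop (fun n => (hF n).aestronglyMeasurable)
      (Eventually.of_forall hlim)
  refine ⟨hmeas, ?_⟩
  have h1 : ∫⁻ x, ‖f x‖ₑ ∂μ ≤ liminf (fun n => ∫⁻ x, ‖F n x‖ₑ ∂μ) atTop := by
    rw [lintegral_congr fun x => (hlim x).enorm.liminf_eq.symm]
    exact lintegral_liminf_le' fun n => (hF n).aestronglyMeasurable.enorm
  have h2 : ∀ n, ∫⁻ x, ‖F n x‖ₑ ∂μ ≤ ENNReal.ofReal C := by
    intro n
    have : ∫⁻ x, ‖F n x‖ₑ ∂μ = ENNReal.ofReal (∫ x, F n x ∂μ) := by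
      rw [ofReal_integral_eq_lintegral_ofReal (hF n) (Eventually.of_forall (hF0 n))]
      refine lintegral_congr fun x => ?_
      rw [Real.enorm_of_nonneg (hF0 n x)]
    rw [this]
    exact ENNReal.ofReal_le_ofReal (hFC n)
  have h3 : liminf (fun n => ∫⁻ x, ‖F n x‖ₑ ∂μ) atTop ≤ ENNReal.ofReal C := by
    refine le_trans (liminf_le_liminf (Eventually.of_forall h2)) ?_
    simp
  exact lt_of_le_of_lt (h1.trans h3) ENNReal.ofReal_lt_top

/-- A differentiable convex function lies above its tangent lines. -/
lemma ConvexOn.tangent_le {S : Set ℝ} {f : ℝ → ℝ} {x y f' : ℝ} (hf : ConvexOn ℝ S f)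
    (hx : x ∈ S) (hy : y ∈ S) (hd : HasDerivAt f f' x) : f x + f' * (y - x) ≤ f y := by
  rcases lt_trichotomy x y with h | h | h
  · have := hf.le_slope_of_hasDerivAt hx hy h hd
    rw [slope_def_field, le_div_iff₀ (by linarith)] at this
    linarith
  · simp [h]
  · have := hf.slope_le_of_hasDerivAt hy hx h hd
    rw [slope_def_field, div_le_iff₀ (by linarith)] at this
    linarith

/-- If the `φ`-entropies of the truncations of a nonnegative function `h` are bounded and
`φ''` decays at most like `1 / t`, then `h` is integrable. -/
lemma integrable_of_entropy_truncation_le {Ω : Type*} [MeasurableSpace Ω] {μ : Measure Ω}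
    [IsProbabilityMeasure μ] {φ φ' φ'' : ℝ → ℝ} {κ δ C : ℝ}
    (hφ : ConvexOn ℝ (Set.Ici 0) φ) (hφc : ContinuousOn φ (Set.Ici 0))
    (h1 : ∀ t, 0 < t → HasDerivAt φ (φ' t) t)
    (h2 : ∀ t, 0 < t → HasDerivAt φ' (φ'' t) t)
    (hκ : 0 < κ) (hδ : 0 < δ) (h3 : ∀ t, 0 < t → κ ≤ φ'' t * (δ + t))
    {h : Ω → ℝ} (hh : Measurable h) (h0 : ∀ x, 0 ≤ h x)
    (hent : ∀ N : ℕ, (∫ x, φ (min (h x) N) ∂μ) - φ (∫ x, min (h x) N ∂μ) ≤ C) :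
    Integrable h μ := by
  have htail : ∃ M : ℝ, δ ≤ M ∧ 1 / 2 ≤ μ.real {x | h x ≤ M} := by
    have hmono : Monotone fun n : ℕ => {x | h x ≤ (n : ℝ)} := by
      intro a b hab x hx
      exact le_trans (show h x ≤ (a : ℝ) from hx) (by exact_mod_cast hab)
    have hlim := tendsto_measure_iUnion_atTop (μ := μ) hmono
    have hU : (⋃ n : ℕ, {x | h x ≤ (n : ℝ)}) = Set.univ := by
      ext x
      simpa using exists_nat_ge (h x)
    rw [hU, measure_univ] at hlim
    have hlim' := (ENNReal.tendsto_toReal ENNReal.one_ne_top).comp hlim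
    have := hlim'.eventually (eventually_ge_nhds (b := 1 / 2) (by norm_num))
    obtain ⟨n, hn, hn'⟩ := (this.and (eventually_ge_atTop ⌈δ⌉₊)).exists
    exact ⟨n, (Nat.le_ceil δ).trans (by exact_mod_cast hn'), hn⟩
  obtain ⟨M, hδM, hM⟩ := htail
  have hM0 : 0 < M := hδ.trans_le hδM
  have h3' : ∀ t, 0 < t → 0 ≤ φ'' t := fun t ht => by
    have := h3 t ht
    by_contra hcon
    nlinarith
  have hmono : ∀ {s t : ℝ}, 0 < s → s ≤ t → φ' s ≤ φ' t := by
    intro s t hs hst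
    have : MonotoneOn φ' (Set.Ioi 0) := by
      refine monotoneOn_of_deriv_nonneg (convex_Ioi 0)
        (fun t ht => (h2 t ht).continuousAt.continuousWithinAt) ?_ ?_
      · rw [interior_Ioi]
        exact fun t ht => (h2 t ht).differentiableAt.differentiableWithinAt
      · rw [interior_Ioi]
        intro t ht
        rw [(h2 t ht).deriv]
        exact h3' t ht
    exact this hs (hs.trans_le hst) hst
  have hD : ∀ m, 2 * M ≤ m → κ / 4 * (m - 2 * M) ≤ φ M - φ m - φ' m * (M - m) := by
    have hd : ∀ t, 0 < t → HasDerivAt (fun m => φ M - φ m - φ' m * (M - m) - κ / 4 * (m - 2 * M))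
        (φ'' t * (t - M) - κ / 4) t := by
      intro t ht
      have := ((((h1 t ht).const_sub (φ M)).sub
        ((h2 t ht).mul ((hasDerivAt_id t).const_sub M))).sub
        (((hasDerivAt_id t).sub_const (2 * M)).const_mul (κ / 4)))
      refine this.congr_deriv ?_
      simp
      ring
    have hmon : MonotoneOn (fun m => φ M - φ m - φ' m * (M - m) - κ / 4 * (m - 2 * M))
        (Set.Ici (2 * M)) := by
      refine monotoneOn_of_deriv_nonneg (convex_Ici _)
        (fun t ht => (hd t (by linarith [Set.mem_Ici.1 ht])).continuousAt.continuousWithinAt) ?_ ?_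
      · rw [interior_Ici]
        exact fun t ht => (hd t
          (by linarith [Set.mem_Ioi.1 ht])).differentiableAt.differentiableWithinAt
      · rw [interior_Ici]
        intro t ht
        have ht' : 2 * M < t := ht
        rw [(hd t (by linarith)).deriv]
        have h4 := h3 t (by linarith)
        have h5 := h3' t (by linarith)
        nlinarith
    intro m hm
    have h6 := hmon (Set.mem_Ici.2 le_rfl) (Set.mem_Ici.2 hm) hm
    have h7 := hφ.tangent_le (x := 2 * M) (y := M) (by simp; linarith) (by simp; linarith)
      (h1 _ (by linarith))
    simp only at h6
    linarith
  have hbdd : ∀ N : ℕ, Integrable (fun x => min (h x) N) μ := fun N =>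
    Integrable.of_bound (hh.min measurable_const).aestronglyMeasurable N
      (Eventually.of_forall fun x => by
        rw [Real.norm_of_nonneg (le_min (h0 x) (Nat.cast_nonneg N))]
        exact min_le_right _ _)
  refine integrable_of_tendsto_of_integral_le (F := fun (N : ℕ) x => min (h x) N)
    (C := 2 * M + 8 * |C| / κ) hbdd (fun N x => le_min (h0 x) (Nat.cast_nonneg N)) ?_ ?_
  · intro N
    set m := ∫ x, min (h x) N ∂μ with hm
    by_contra! hcon
    have hC : 0 ≤ 8 * |C| / κ := by positivity
    have hm2 : 2 * M < m := by linarith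
    have hφi : Integrable (fun x => φ (min (h x) N)) μ := by
      obtain ⟨B, hB⟩ := (isCompact_Icc (a := (0 : ℝ)) (b := N)).exists_bound_of_continuousOn
        (hφc.mono Set.Icc_subset_Ici_self)
      have hmem : ∀ x, min (h x) N ∈ Set.Ici (0 : ℝ) := fun x => le_min (h0 x) (Nat.cast_nonneg N)
      have hm : Measurable (fun x => φ (min (h x) N)) := by
        have h8 : Continuous ((Set.Ici (0 : ℝ)).domRestrict φ) :=
          continuousOn_iff_continuous_domRestrict.1 hφc
        exact h8.measurable.comp ((hh.min measurable_const).subtype_mk (h := hmem))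
      exact Integrable.of_bound hm.aestronglyMeasurable B
        (Eventually.of_forall fun x => hB _ ⟨hmem x, min_le_right _ _⟩)
    have hlow : ∀ x, Set.indicator {x | h x ≤ M} (fun _ => φ M - φ m - φ' m * (M - m)) x ≤
        φ (min (h x) N) - φ m - φ' m * (min (h x) N - m) := by
      intro x
      have hg0 : 0 ≤ min (h x) (N : ℝ) := le_min (h0 x) (Nat.cast_nonneg N)
      by_cases hx : h x ≤ M
      · rw [Set.indicator_of_mem (by exact hx)]
        have h9 := hφ.tangent_le (x := M) (y := min (h x) N) (by simp; linarith) hg0 (h1 _ hM0)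
        have h10 := hmono hM0 (by linarith : M ≤ m)
        have h11 : min (h x) (N : ℝ) ≤ M := (min_le_left _ _).trans hx
        nlinarith
      · rw [Set.indicator_of_notMem (by exact hx)]
        have h9 := hφ.tangent_le (x := m) (y := min (h x) N) (by simp; linarith) hg0
          (h1 _ (by linarith))
        linarith
    have hS : MeasurableSet {x | h x ≤ M} := measurableSet_le hh measurable_const
    have hint := integral_mono ((integrable_const _).indicator hS)
      ((hφi.sub (integrable_const (φ m))).sub
        (((hbdd N).sub (integrable_const m)).const_mul (φ' m))) hlow
    rw [integral_indicator_const _ hS] at hint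
    have hi1 : Integrable (fun x => φ (min (h x) N) - φ m) μ := hφi.sub (integrable_const _)
    have hi2 : Integrable (fun x => φ' m * (min (h x) N - m)) μ :=
      ((hbdd N).sub (integrable_const m)).const_mul _
    have heq : ∫ x, φ (min (h x) N) - φ m - φ' m * (min (h x) N - m) ∂μ =
        (∫ x, φ (min (h x) N) ∂μ) - φ m := by
      rw [integral_sub hi1 hi2, integral_sub hφi (integrable_const _), integral_const_mul,
        integral_sub (hbdd N) (integrable_const _), ← hm]
      simp
    rw [smul_eq_mul] at hint
    replace hint := hint.trans_eq heq
    have h12 := hent N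
    rw [← hm] at h12
    have h13 := hD m hm2.le
    have h14 : κ / 4 * (8 * |C| / κ) < κ / 4 * (m - 2 * M) :=
      mul_lt_mul_of_pos_left (by linarith) (by positivity)
    have h15 : κ / 4 * (8 * |C| / κ) = 2 * |C| := by field_simp; ring
    have h16 : 0 ≤ φ M - φ m - φ' m * (M - m) := by linarith [abs_nonneg C]
    have h17 : 1 / 2 * (φ M - φ m - φ' m * (M - m)) ≤
      μ.real {x | h x ≤ M} * (φ M - φ m - φ' m * (M - m)) := mul_le_mul_of_nonneg_right hM h16
    linarith [le_abs_self C]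
  · intro x
    refine tendsto_const_nhds.congr' ?_
    filter_upwards [eventually_ge_atTop ⌈h x⌉₊] with N hN
    exact (min_eq_left ((Nat.le_ceil _).trans (by exact_mod_cast hN))).symm

/-- `ψ` is a continuous version on `I` of the second derivative of the convex function `Φ`, and
`(u, v) ↦ ψ u * v ^ 2` is nonnegative and convex on `I × ℝ`. -/
structure IsEntropyPair (I : Set ℝ) (Φ ψ : ℝ → ℝ) : Prop where
  convex : Convex ℝ I
  closed : IsClosed I
  nonempty : (interior I).Nonempty
  contDiffOn : ContDiffOn ℝ 2 Φ I
  convexOn : ConvexOn ℝ I Φ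
  continuousOn : ContinuousOn ψ I
  nonneg : ∀ u ∈ I, 0 ≤ ψ u
  convexOn_quad : ConvexOn ℝ (I ×ˢ (Set.univ : Set ℝ)) (fun p : ℝ × ℝ => ψ p.1 * p.2 ^ 2)
  hasDerivAt_deriv : ∀ u ∈ interior I, HasDerivAt (deriv Φ) (ψ u) u
  affine_of_eq_zero : (∀ u ∈ I, ψ u = 0) → ∃ a b, ∀ u ∈ I, Φ u = a + b * u

/-- A point of a convex subset of `ℝ` that is not interior is a least or a greatest element. -/
lemma forall_le_or_forall_ge_of_notMem_interior {I : Set ℝ} (hI : Convex ℝ I) {x : ℝ}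
    (hx : x ∉ interior I) : (∀ y ∈ I, x ≤ y) ∨ (∀ y ∈ I, y ≤ x) := by
  by_contra! h
  obtain ⟨⟨a, ha, hax⟩, ⟨b, hb, hxb⟩⟩ := h
  exact hx (mem_interior.2 ⟨Set.Ioo a b,
    Set.Ioo_subset_Icc_self.trans (hI.ordConnected.out ha hb), isOpen_Ioo, hax, hxb⟩)

/-- An unbounded convex subset of `ℝ` contains a ray from each of its points. -/
lemma exists_ray_mem {I : Set ℝ} (hconv : Convex ℝ I) (hI : ¬ Bornology.IsBounded I) {p : ℝ}
    (hpI : p ∈ I) : ∃ s : ℝ, s * s = 1 ∧ ∀ t, 0 ≤ t → p + s * t ∈ I := by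
  rw [isBounded_iff_bddBelow_bddAbove, not_and_or] at hI
  rcases hI with h | h
  · refine ⟨-1, by norm_num, fun t ht => ?_⟩
    obtain ⟨w, hw, hw'⟩ := not_bddBelow_iff.1 h (p + -1 * t)
    exact hconv.ordConnected.out hw hpI ⟨hw'.le, by linarith⟩
  · refine ⟨1, by norm_num, fun t ht => ?_⟩
    obtain ⟨w, hw, hw'⟩ := not_bddAbove_iff.1 h (p + 1 * t)
    exact hconv.ordConnected.out hpI hw ⟨by linarith, hw'.le⟩

/-- The Fréchet derivative of an `I`-valued function vanishes wherever the value is not interior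
to `I`. -/
lemma fderiv_eq_zero_of_notMem_interior {E : Type*} [NormedAddCommGroup E] [NormedSpace ℝ E]
    {I : Set ℝ} (hI : Convex ℝ I) {g : E → ℝ} (hg : ∀ x, g x ∈ I) {x : E}
    (hx : g x ∉ interior I) : fderiv ℝ g x = 0 := by
  rcases forall_le_or_forall_ge_of_notMem_interior hI hx with h | h
  · exact IsLocalMin.fderiv_eq_zero (Eventually.of_forall fun y => h _ (hg y))
  · exact IsLocalMax.fderiv_eq_zero (Eventually.of_forall fun y => h _ (hg y))

lemma deriv_eq_zero_of_notMem_interior {I : Set ℝ} (hI : Convex ℝ I) {f : ℝ → ℝ}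
    (hf : ∀ x, f x ∈ I) {x : ℝ} (hx : f x ∉ interior I) : deriv f x = 0 := by
  rw [← fderiv_apply_one_eq_deriv, fderiv_eq_zero_of_notMem_interior hI hf hx]
  simp

lemma IsEntropyPair.of_contDiffOn {I : Set ℝ} {Φ : ℝ → ℝ} (hI : Convex ℝ I) (hIc : IsClosed I)
    (hIn : (interior I).Nonempty) (hΦ : ContDiffOn ℝ 2 Φ I) (hΦconv : ConvexOn ℝ I Φ)
    (hnonneg : ∀ u ∈ I, ∀ v : ℝ, 0 ≤ deriv (deriv Φ) u * v ^ 2)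
    (hconv : ConvexOn ℝ (I ×ˢ (Set.univ : Set ℝ))
      (fun p : ℝ × ℝ => deriv (deriv Φ) p.1 * p.2 ^ 2)) :
    ∃ ψ, IsEntropyPair I Φ ψ ∧ ∀ u ∈ interior I, deriv (deriv Φ) u = ψ u := by
  have huniq : UniqueDiffOn ℝ I := uniqueDiffOn_convex hI hIn
  have hcl : closure (interior I) = I := by
    rw [hI.closure_interior_eq_closure_of_nonempty_interior hIn, hIc.closure_eq]
  have h1 : ContDiffOn ℝ 1 (derivWithin Φ I) I := hΦ.derivWithin huniq (by norm_num)
  have h2 : ContinuousOn (derivWithin (derivWithin Φ I) I) I :=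
    h1.continuousOn_derivWithin huniq le_rfl
  have hev : ∀ u ∈ interior I, deriv Φ =ᶠ[𝓝 u] derivWithin Φ I := by
    intro u hu
    filter_upwards [isOpen_interior.mem_nhds hu] with y hy
    exact (derivWithin_of_mem_nhds (mem_interior_iff_mem_nhds.1 hy)).symm
  have hd : ∀ u ∈ interior I, HasDerivAt (deriv Φ) (derivWithin (derivWithin Φ I) I u) u := by
    intro u hu
    have h3 : HasDerivAt (derivWithin Φ I) (derivWithin (derivWithin Φ I) I u) u :=
      ((h1.differentiableOn one_ne_zero u (interior_subset hu)).hasDerivWithinAt).hasDerivAt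
        (mem_interior_iff_mem_nhds.1 hu)
    exact h3.congr_of_eventuallyEq (hev u hu)
  refine ⟨derivWithin (derivWithin Φ I) I,
    ⟨hI, hIc, hIn, hΦ, hΦconv, h2, ?_, ⟨hI.prod convex_univ, ?_⟩, hd, ?_⟩,
    fun u hu => (hd u hu).deriv⟩
  · intro u hu
    refine le_on_closure (s := interior I) (f := fun _ => (0 : ℝ)) ?_ continuousOn_const
      (by rwa [hcl]) (by rwa [hcl])
    intro y hy
    rw [← (hd y hy).deriv]
    simpa using hnonneg y (interior_subset hy) 1
  · intro x hx y hy a b ha hb hab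
    have hcl2 : closure ((interior I ×ˢ (Set.univ : Set ℝ)) ×ˢ (interior I ×ˢ (Set.univ : Set ℝ)))
        = (I ×ˢ (Set.univ : Set ℝ)) ×ˢ (I ×ˢ (Set.univ : Set ℝ)) := by
      simp only [closure_prod_eq, hcl, closure_univ]
    set ψ := derivWithin (derivWithin Φ I) I
    have hq : ContinuousOn (fun p : ℝ × ℝ => ψ p.1 * p.2 ^ 2) (I ×ˢ (Set.univ : Set ℝ)) :=
      (h2.comp continuousOn_fst fun p hp => hp.1).mul (continuousOn_snd.pow 2)
    refine le_on_closure
      (s := (interior I ×ˢ (Set.univ : Set ℝ)) ×ˢ (interior I ×ˢ (Set.univ : Set ℝ)))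
      (f := fun z : (ℝ × ℝ) × (ℝ × ℝ) =>
        (fun p : ℝ × ℝ => ψ p.1 * p.2 ^ 2) (a • z.1 + b • z.2))
      (g := fun z => a • (fun p : ℝ × ℝ => ψ p.1 * p.2 ^ 2) z.1 +
        b • (fun p : ℝ × ℝ => ψ p.1 * p.2 ^ 2) z.2)
      ?_ ?_ ?_ (x := (x, y)) (by rw [hcl2]; exact ⟨hx, hy⟩)
    · rintro ⟨z, w⟩ ⟨hz, hw⟩
      have hm : a • z + b • w ∈ interior I ×ˢ (Set.univ : Set ℝ) :=
        (hI.interior.prod convex_univ) hz hw ha hb hab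
      have := hconv.2 (x := z) ⟨interior_subset hz.1, trivial⟩ (y := w)
        ⟨interior_subset hw.1, trivial⟩ ha hb hab
      simp only [(hd _ hz.1).deriv, (hd _ hw.1).deriv, (hd _ hm.1).deriv] at this
      exact this
    · rw [hcl2]
      refine hq.comp (by fun_prop) ?_
      rintro ⟨z, w⟩ ⟨hz, hw⟩
      exact (hI.prod convex_univ) hz hw ha hb hab
    · rw [hcl2]
      exact ((hq.comp continuousOn_fst fun z hz => hz.1).const_smul a).add
        ((hq.comp continuousOn_snd fun z hz => hz.2).const_smul b)
  · intro h0
    obtain ⟨p, hp⟩ := hIn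
    have hpI := interior_subset hp
    refine ⟨Φ p - derivWithin Φ I p * p, derivWithin Φ I p, fun u hu => ?_⟩
    have hc : ∀ v ∈ I, derivWithin Φ I v = derivWithin Φ I p := by
      intro v hv
      refine hI.is_const_of_fderivWithin_eq_zero (𝕜 := ℝ) (h1.differentiableOn one_ne_zero) ?_ hv hpI
      intro w hw
      ext
      exact h0 w hw
    have hdiff : ∀ w ∈ I, HasDerivWithinAt (fun v => Φ v - derivWithin Φ I p * v) 0 I w := by
      intro w hw
      have := (hΦ.differentiableOn two_ne_zero w hw).hasDerivWithinAt.sub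
        ((hasDerivWithinAt_id w I).const_mul (derivWithin Φ I p))
      refine this.congr_deriv ?_
      rw [hc w hw]
      simp
    have := hI.is_const_of_fderivWithin_eq_zero (𝕜 := ℝ)
      (f := fun v => Φ v - derivWithin Φ I p * v)
      (fun w hw => (hdiff w hw).differentiableWithinAt) (fun w hw => by
        ext
        exact (hdiff w hw).derivWithin (huniq w hw)) hu hpI
    linarith

namespace IsEntropyPair

variable {I : Set ℝ} {Φ ψ : ℝ → ℝ}

lemma closure_interior (H : IsEntropyPair I Φ ψ) : closure (interior I) = I := by
  rw [H.convex.closure_interior_eq_closure_of_nonempty_interior H.nonempty, H.closed.closure_eq]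

lemma hasDerivAt (H : IsEntropyPair I Φ ψ) {u : ℝ} (hu : u ∈ interior I) :
    HasDerivAt Φ (deriv Φ u) u :=
  ((H.contDiffOn.differentiableOn two_ne_zero u (interior_subset hu)).differentiableAt
    (mem_interior_iff_mem_nhds.1 hu)).hasDerivAt

lemma exists_affine_le (H : IsEntropyPair I Φ ψ) : ∃ a b, ∀ u ∈ I, a + b * u ≤ Φ u := by
  obtain ⟨p, hp⟩ := H.nonempty
  refine ⟨Φ p - deriv Φ p * p, deriv Φ p, fun u hu => ?_⟩
  have := H.convexOn.tangent_le (interior_subset hp) hu (H.hasDerivAt hp)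
  linarith

lemma mul_le_of_mem (H : IsEntropyPair I Φ ψ) {a b t : ℝ} (ha : a ∈ I) (hb : b ∈ I)
    (ht : 0 < t) (ht1 : t ≤ 1) : ψ ((1 - t) * a + t * b) * t ≤ ψ b := by
  have := H.convexOn_quad.2 (x := (a, 0)) ⟨ha, trivial⟩ (y := (b, 1)) ⟨hb, trivial⟩
    (sub_nonneg.2 ht1) ht.le (by ring)
  simp at this
  nlinarith

lemma exists_forall_le (H : IsEntropyPair I Φ ψ) : ∃ B, 0 ≤ B ∧ ∀ u ∈ I, ψ u ≤ B := by
  obtain ⟨p, hp⟩ := H.nonempty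
  have hpI := interior_subset hp
  have key : ∀ u ∈ I, 2 * u - p ∈ I → ψ u ≤ 2 * ψ p := by
    intro u _ hu
    have := H.mul_le_of_mem hu hpI (t := 1 / 2) (by norm_num) (by norm_num)
    rw [show (1 - 1 / 2) * (2 * u - p) + 1 / 2 * p = u by ring] at this
    linarith
  have hup : ∃ B, ∀ u ∈ I, p ≤ u → ψ u ≤ B := by
    by_cases hb : BddAbove I
    · obtain ⟨M, hM⟩ := hb
      obtain ⟨B, hB⟩ := ((isCompact_Icc (a := p) (b := M)).inter_left
        H.closed).exists_bound_of_continuousOn (H.continuousOn.mono Set.inter_subset_left)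
      exact ⟨B, fun u hu hpu => (le_abs_self _).trans (hB u ⟨hu, hpu, hM hu⟩)⟩
    · refine ⟨2 * ψ p, fun u hu hpu => key u hu ?_⟩
      obtain ⟨w, hw, hw'⟩ := not_bddAbove_iff.1 hb (2 * u - p)
      exact H.convex.ordConnected.out hpI hw ⟨by linarith, hw'.le⟩
  have hdown : ∃ B, ∀ u ∈ I, u ≤ p → ψ u ≤ B := by
    by_cases hb : BddBelow I
    · obtain ⟨M, hM⟩ := hb
      obtain ⟨B, hB⟩ := ((isCompact_Icc (a := M) (b := p)).inter_left
        H.closed).exists_bound_of_continuousOn (H.continuousOn.mono Set.inter_subset_left)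
      exact ⟨B, fun u hu hpu => (le_abs_self _).trans (hB u ⟨hu, hM hu, hpu⟩)⟩
    · refine ⟨2 * ψ p, fun u hu hpu => key u hu ?_⟩
      obtain ⟨w, hw, hw'⟩ := not_bddBelow_iff.1 hb (2 * u - p)
      exact H.convex.ordConnected.out hw hpI ⟨hw'.le, by linarith⟩
  obtain ⟨B₁, h₁⟩ := hup
  obtain ⟨B₂, h₂⟩ := hdown
  refine ⟨max B₁ B₂, (H.nonneg p hpI).trans ((h₁ p hpI le_rfl).trans (le_max_left _ _)),
    fun u hu => ?_⟩
  rcases le_total p u with h | h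
  · exact (h₁ u hu h).trans (le_max_left _ _)
  · exact (h₂ u hu h).trans (le_max_right _ _)

lemma continuous_comp {X : Type*} [TopologicalSpace X] (H : IsEntropyPair I Φ ψ) {g : X → ℝ}
    (hg : Continuous g) (hgI : ∀ x, g x ∈ I) : Continuous fun x => Φ (g x) :=
  H.contDiffOn.continuousOn.comp_continuous hg hgI

/-- If the `Φ`-entropy is controlled by the Lipschitz constant, then `Φ ∘ g` is integrable for
every integrable Lipschitz `I`-valued function `g`. -/
lemma integrable_comp {E : Type*} [PseudoMetricSpace E] [MeasurableSpace E] [BorelSpace E]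
    {μ : Measure E} [IsProbabilityMeasure μ] (H : IsEntropyPair I Φ ψ) {C : ℝ}
    (hE : ∀ (K : NNReal) (g : E → ℝ), LipschitzWith K g → (∀ x, g x ∈ I) →
      (∫ x, Φ (g x) ∂μ) - Φ (∫ x, g x ∂μ) ≤ C * (K : ℝ) ^ 2)
    {K : NNReal} {g : E → ℝ} (hg : LipschitzWith K g) (hgI : ∀ x, g x ∈ I)
    (hint : Integrable g μ) : Integrable (fun x => Φ (g x)) μ := by
  obtain ⟨p, hp⟩ := H.nonempty
  have hpI := interior_subset hp
  obtain ⟨a, b, hab⟩ := H.exists_affine_le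
  set G : ℕ → E → ℝ := fun N x => max (p - N) (min (g x) (p + N)) with hG
  have hGL : ∀ N, LipschitzWith K (G N) := fun N => (hg.min_const _).const_max _
  have hGI : ∀ N x, G N x ∈ I := by
    intro N x
    have hN : (0 : ℝ) ≤ N := Nat.cast_nonneg N
    refine H.convex.ordConnected.uIcc_subset hpI (hgI x) ?_
    rw [Set.mem_uIcc]
    rcases le_total p (g x) with h | h
    · exact Or.inl ⟨le_max_of_le_right (le_min h (by linarith)),
        max_le (by linarith) (min_le_left _ _)⟩
    · exact Or.inr ⟨le_max_of_le_right (le_min le_rfl (by linarith)),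
        max_le (by linarith) ((min_le_left _ _).trans h)⟩
  have hGb : ∀ N x, p - N ≤ G N x ∧ G N x ≤ p + N := by
    intro N x
    have hN : (0 : ℝ) ≤ N := Nat.cast_nonneg N
    exact ⟨le_max_left _ _, max_le (by linarith) (min_le_right _ _)⟩
  have hGp : ∀ N x, |G N x - p| ≤ |g x - p| := by
    intro N x
    have hN : (0 : ℝ) ≤ N := Nat.cast_nonneg N
    simp only [hG]
    rcases max_cases (p - (N : ℝ)) (min (g x) (p + N)) with h | h <;>
      rcases min_cases (g x) (p + N) with h' | h' <;>
      rw [abs_le] <;> constructor <;> rcases abs_cases (g x - p) with h'' | h'' <;> linarith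
  have hGi : ∀ N, Integrable (G N) μ := fun N =>
    Integrable.of_mem_Icc _ _ (hGL N).continuous.measurable.aemeasurable
      (Eventually.of_forall fun x => hGb N x)
  have hΦi : ∀ N, Integrable (fun x => Φ (G N x)) μ := by
    intro N
    obtain ⟨B, hB⟩ := ((isCompact_Icc (a := p - N) (b := p + N)).inter_left
        H.closed).exists_bound_of_continuousOn
        (H.contDiffOn.continuousOn.mono Set.inter_subset_left)
    exact Integrable.of_bound
      (H.continuous_comp (hGL N).continuous (hGI N)).measurable.aestronglyMeasurable B
      (Eventually.of_forall fun x => hB _ ⟨hGI N x, hGb N x⟩)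
  have hgp : Integrable (fun x => |g x - p|) μ := (hint.sub (integrable_const p)).abs
  set R := ∫ x, |g x - p| ∂μ with hR
  have hm : ∀ N, |(∫ x, G N x ∂μ) - p| ≤ R := by
    intro N
    have : (∫ x, G N x ∂μ) - p = ∫ x, G N x - p ∂μ := by
      rw [integral_sub (hGi N) (integrable_const _)]
      simp
    rw [this]
    exact abs_integral_le_integral_abs.trans
      (integral_mono ((hGi N).sub (integrable_const p)).abs hgp (hGp N))
  have hmI : ∀ N, ∫ x, G N x ∂μ ∈ I := fun N =>
    H.convex.integral_mem H.closed (Eventually.of_forall (hGI N)) (hGi N)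
  obtain ⟨B, hB⟩ := ((isCompact_Icc (a := p - R) (b := p + R)).inter_left
    H.closed).exists_bound_of_continuousOn (f := fun u => Φ u - (a + b * u))
    ((H.contDiffOn.continuousOn.mono Set.inter_subset_left).sub (by fun_prop))
  have hlini : ∀ N, Integrable (fun x => a + b * G N x) μ := fun N =>
    (integrable_const a).add ((hGi N).const_mul b)
  have hmain : Integrable (fun x => Φ (g x) - (a + b * g x)) μ := by
    refine integrable_of_tendsto_of_integral_le (F := fun N x => Φ (G N x) - (a + b * G N x))
      (C := C * (K : ℝ) ^ 2 + B) (fun N => (hΦi N).sub (hlini N))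
      (fun N x => sub_nonneg.2 (hab _ (hGI N x))) ?_ ?_
    · intro N
      rw [integral_sub (hΦi N) (hlini N), integral_add (integrable_const a) ((hGi N).const_mul b),
        integral_const_mul]
      have h1 := hE K (G N) (hGL N) (hGI N)
      have h2 := (le_abs_self _).trans (hB (∫ x, G N x ∂μ) ⟨hmI N, by
        have := abs_le.1 (hm N)
        constructor <;> linarith⟩)
      simp
      linarith
    · intro x
      refine tendsto_const_nhds.congr' ?_
      filter_upwards [eventually_ge_atTop ⌈|g x - p|⌉₊] with N hN
      have h1 : |g x - p| ≤ N := (Nat.le_ceil _).trans (by exact_mod_cast hN)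
      have h2 := abs_le.1 h1
      have : G N x = g x := by
        simp only [hG]
        rw [min_eq_left (by linarith), max_eq_right (by linarith)]
      rw [this]
  have := hmain.add ((integrable_const a).add (hint.const_mul b))
  refine this.congr (Eventually.of_forall fun x => ?_)
  simp

/-- If `I` is unbounded, `ψ` does not vanish identically, and the `Φ`-entropy is controlled by the
Lipschitz constant, then all Lipschitz functions are integrable. -/
lemma integrable_of_lipschitz {E : Type*} [PseudoMetricSpace E] [MeasurableSpace E] [BorelSpace E]
    {μ : Measure E} [IsProbabilityMeasure μ] (H : IsEntropyPair I Φ ψ) {C : ℝ}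
    (hE : ∀ (K : NNReal) (g : E → ℝ), LipschitzWith K g → (∀ x, g x ∈ I) →
      (∫ x, Φ (g x) ∂μ) - Φ (∫ x, g x ∂μ) ≤ C * (K : ℝ) ^ 2)
    (hI : ¬ Bornology.IsBounded I) (hψ : ¬ ∀ u ∈ I, ψ u = 0)
    {K : NNReal} {g : E → ℝ} (hg : LipschitzWith K g) : Integrable g μ := by
  obtain ⟨p, hp, hψp⟩ : ∃ p ∈ interior I, 0 < ψ p := by
    by_contra! hcon
    refine hψ fun u hu => le_antisymm ?_ (H.nonneg u hu)
    have hc := H.continuousOn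
    rw [← H.closure_interior] at hu hc
    exact le_on_closure (g := fun _ => (0 : ℝ)) hcon hc continuousOn_const hu
  have hpI := interior_subset hp
  obtain ⟨s, hs, hray⟩ := exists_ray_mem H.convex hI hpI
  have hrayint : ∀ t, 0 ≤ t → p + s * t ∈ interior I := by
    intro t ht
    have := H.convex.combo_interior_self_mem_interior hp (hray (2 * t) (by linarith))
      (a := 1 / 2) (b := 1 / 2) (by norm_num) (by norm_num) (by norm_num)
    convert this using 1
    simp only [smul_eq_mul]
    ring
  obtain ⟨δ, hδ, hball⟩ := Metric.isOpen_iff.1 isOpen_interior p hp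
  have hs1 : |s| = 1 := by
    rcases mul_self_eq_one_iff.1 hs with h | h <;> simp [h]
  have hback : p - s * (δ / 2) ∈ I := interior_subset (hball (by
    rw [Metric.mem_ball, Real.dist_eq, sub_sub_cancel_left, abs_neg, abs_mul, hs1, one_mul,
      abs_of_pos (by linarith)]
    linarith))
  have hlin : ∀ t, HasDerivAt (fun t => p + s * t) s t := fun t => by
    simpa using ((hasDerivAt_id t).const_mul s).const_add p
  have hnn : ∀ {h : E → ℝ}, LipschitzWith K h → (∀ x, 0 ≤ h x) → Integrable h μ := by
    intro h hh h0
    refine integrable_of_entropy_truncation_le (φ := fun t => Φ (p + s * t))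
      (φ' := fun t => deriv Φ (p + s * t) * s) (φ'' := fun t => ψ (p + s * t)) (κ := ψ p * (δ / 2))
      (δ := δ / 2) (C := C * (K : ℝ) ^ 2) ?_ ?_ ?_ ?_ (by positivity) (by positivity) ?_
      hh.continuous.measurable h0 ?_
    · refine ⟨convex_Ici 0, fun x hx y hy a b ha hb hab => ?_⟩
      have := H.convexOn.2 (hray x hx) (hray y hy) ha hb hab
      convert this using 2
      simp only [smul_eq_mul]
      linear_combination (-p) * hab
    · exact H.contDiffOn.continuousOn.comp (by fun_prop) fun t ht => hray t ht
    · exact fun t ht => (H.hasDerivAt (hrayint t ht.le)).comp t (hlin t)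
    · intro t ht
      have := ((H.hasDerivAt_deriv _ (hrayint t ht.le)).comp t (hlin t)).mul_const s
      refine this.congr_deriv ?_
      rw [mul_assoc, hs, mul_one]
    · intro t ht
      have h1 := H.mul_le_of_mem hback (hray t ht.le) (t := (δ / 2) / (δ / 2 + t)) (by positivity)
        (by rw [div_le_one (by positivity)]; linarith)
      rw [show (1 - δ / 2 / (δ / 2 + t)) * (p - s * (δ / 2)) + δ / 2 / (δ / 2 + t) * (p + s * t) = p
        by field_simp; ring, ← mul_div_assoc, div_le_iff₀ (by positivity)] at h1
      exact h1
    · intro N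
      have hL : LipschitzWith K fun x => p + s * min (h x) N := by
        refine LipschitzWith.of_dist_le_mul fun x y => ?_
        have := (hh.min_const (N : ℝ)).dist_le_mul x y
        rw [Real.dist_eq] at this ⊢
        rw [add_sub_add_left_eq_sub, ← mul_sub, abs_mul, hs1, one_mul]
        exact this
      have hi : Integrable (fun x => min (h x) (N : ℝ)) μ :=
        Integrable.of_mem_Icc 0 N (hh.min_const _).continuous.measurable.aemeasurable
          (Eventually.of_forall fun x => ⟨le_min (h0 x) (Nat.cast_nonneg N), min_le_right _ _⟩)
      have h1 := hE K _ hL fun x => hray _ (le_min (h0 x) (Nat.cast_nonneg N))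
      rw [integral_add (integrable_const p) (hi.const_mul s), integral_const_mul] at h1
      simpa using h1
  have habs : LipschitzWith K fun x => |g x| := by
    refine LipschitzWith.of_dist_le_mul fun x y => ?_
    exact (abs_abs_sub_abs_le_abs_sub (g x) (g y)).trans (hg.dist_le_mul x y)
  exact (hnn habs fun x => abs_nonneg _).mono' hg.continuous.measurable.aestronglyMeasurable
    (Eventually.of_forall fun x => le_rfl)

end IsEntropyPair

/-- A `Φ`-Sobolev inequality with constant `C` for the measure `ν` on `ℝ`, together with the
integrability statements that give it a meaning. -/
structure PhiSobolevOn (I : Set ℝ) (Φ ψ : ℝ → ℝ) (ν : Measure ℝ) (C : ℝ) : Prop where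
  integrable_id : ¬ Bornology.IsBounded I → Integrable (fun x => x) ν
  integrable_comp : ∀ f : ℝ → ℝ, ContDiff ℝ 1 f → (∀ x, f x ∈ I) →
    (∃ L : ℝ, ∀ x, |deriv f x| ≤ L) → Integrable (fun x => Φ (f x)) ν
  entropy_le : ∀ f : ℝ → ℝ, ContDiff ℝ 1 f → (∀ x, f x ∈ I) →
    (∃ L : ℝ, ∀ x, |deriv f x| ≤ L) →
    (∫ y, Φ (f y) ∂ν) - Φ (∫ y, f y ∂ν) ≤ C * ∫ y, ψ (f y) * |deriv f y| ^ 2 ∂ν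

lemma lipschitzWith_of_abs_deriv_le {f : ℝ → ℝ} (hf : ContDiff ℝ 1 f) {L : ℝ}
    (hL : ∀ x, |deriv f x| ≤ L) : LipschitzWith L.toNNReal f := by
  refine lipschitzWith_of_nnnorm_deriv_le (hf.differentiable one_ne_zero) fun x => ?_
  rw [← NNReal.coe_le_coe, coe_nnnorm, Real.norm_eq_abs]
  exact (hL x).trans (Real.le_coe_toNNReal L)

/-- A Lipschitz function with values in a bounded set is integrable, and so is any Lipschitz
function if the identity is integrable. -/
lemma integrable_of_isBounded_or_integrable_id {I : Set ℝ} {ν : Measure ℝ} [IsFiniteMeasure ν]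
    (hν : ¬ Bornology.IsBounded I → Integrable (fun x => x) ν) {K : NNReal} {f : ℝ → ℝ}
    (hf : LipschitzWith K f) (hfI : ∀ x, f x ∈ I) : Integrable f ν := by
  by_cases hI : Bornology.IsBounded I
  · obtain ⟨B, hB⟩ := hI.exists_norm_le
    exact Integrable.of_bound hf.continuous.measurable.aestronglyMeasurable B
      (Eventually.of_forall fun x => hB _ (hfI x))
  · refine Integrable.mono' ((integrable_const |f 0|).add ((hν hI).abs.const_mul (K : ℝ)))
      hf.continuous.measurable.aestronglyMeasurable (Eventually.of_forall fun x => ?_)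
    have := hf.dist_le_mul x 0
    rw [Real.dist_eq, Real.dist_eq, sub_zero] at this
    have h2 := abs_sub_abs_le_abs_sub (f x) (f 0)
    simp only [Pi.add_apply, Real.norm_eq_abs]
    linarith

lemma IsEntropyPair.continuous_quad {I : Set ℝ} {Φ ψ : ℝ → ℝ} (H : IsEntropyPair I Φ ψ) {f : ℝ → ℝ}
    (hf : ContDiff ℝ 1 f) (hfI : ∀ x, f x ∈ I) : Continuous fun y => ψ (f y) * |deriv f y| ^ 2 :=
  (H.continuousOn.comp_continuous hf.continuous hfI).mul
    ((hf.continuous_deriv le_rfl).abs.pow 2)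

lemma IsEntropyPair.exists_quad_le {I : Set ℝ} {Φ ψ : ℝ → ℝ} (H : IsEntropyPair I Φ ψ) {f : ℝ → ℝ}
    (hfI : ∀ x, f x ∈ I) (hL : ∃ L : ℝ, ∀ x, |deriv f x| ≤ L) :
    ∃ B, ∀ y, ‖ψ (f y) * |deriv f y| ^ 2‖ ≤ B := by
  obtain ⟨B, hB0, hB⟩ := H.exists_forall_le
  obtain ⟨L, hL⟩ := hL
  refine ⟨B * L ^ 2, fun y => ?_⟩
  rw [Real.norm_of_nonneg (mul_nonneg (H.nonneg _ (hfI y)) (by positivity))]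
  exact mul_le_mul (hB _ (hfI y)) (pow_le_pow_left₀ (abs_nonneg _) (hL y) 2) (by positivity) hB0

lemma IsEntropyPair.integrable_quad {I : Set ℝ} {Φ ψ : ℝ → ℝ} (H : IsEntropyPair I Φ ψ) {f : ℝ → ℝ}
    (hf : ContDiff ℝ 1 f) (hfI : ∀ x, f x ∈ I) (hL : ∃ L : ℝ, ∀ x, |deriv f x| ≤ L)
    (ν : Measure ℝ) [IsFiniteMeasure ν] : Integrable (fun y => ψ (f y) * |deriv f y| ^ 2) ν := by
  obtain ⟨B, hB⟩ := H.exists_quad_le hfI hL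
  exact Integrable.of_bound (H.continuous_quad hf hfI).measurable.aestronglyMeasurable B
    (Eventually.of_forall hB)

lemma PhiSobolevOn.dirac_zero (I : Set ℝ) (Φ ψ : ℝ → ℝ) :
    PhiSobolevOn I Φ ψ (Measure.dirac 0) 0 where
  integrable_id _ := integrable_dirac (by simp)
  integrable_comp f _ _ _ := integrable_dirac (by simp)
  entropy_le f _ _ _ := by simp

lemma contDiff_integral_add {ν : Measure ℝ} [IsFiniteMeasure ν] {f : ℝ → ℝ} (hf : ContDiff ℝ 1 f)
    {L : ℝ} (hL : ∀ x, |deriv f x| ≤ L) (hint : ∀ y, Integrable (fun z => f (y + z)) ν) :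
    ContDiff ℝ 1 (fun y => ∫ z, f (y + z) ∂ν) ∧
      ∀ y, deriv (fun y => ∫ z, f (y + z) ∂ν) y = ∫ z, deriv f (y + z) ∂ν := by
  have hc := hf.continuous_deriv le_rfl
  have hd : ∀ y, HasDerivAt (fun y => ∫ z, f (y + z) ∂ν) (∫ z, deriv f (y + z) ∂ν) y := by
    intro y
    refine (hasDerivAt_integral_of_dominated_loc_of_deriv_le (F := fun y z => f (y + z))
      (F' := fun y z => deriv f (y + z)) (bound := fun _ => L) univ_mem
      (Eventually.of_forall fun y => (hint y).aestronglyMeasurable) (hint y)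
      (by fun_prop) (Eventually.of_forall fun z y _ => hL _)
      (integrable_const L) (Eventually.of_forall fun z y _ => ?_)).2
    exact ((hf.differentiable one_ne_zero (y + z)).hasDerivAt).comp_add_const y z
  have hd' : deriv (fun y => ∫ z, f (y + z) ∂ν) = fun y => ∫ z, deriv f (y + z) ∂ν :=
    funext fun y => (hd y).deriv
  refine ⟨contDiff_one_iff_deriv.2 ⟨fun y => (hd y).differentiableAt, ?_⟩, congrFun hd'⟩
  rw [hd']
  exact continuous_of_dominated (bound := fun _ => L)
    (fun y => by fun_prop)
    (fun y => Eventually.of_forall fun z => hL _) (integrable_const L)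
    (Eventually.of_forall fun z => by fun_prop)

/-- `Φ`-Sobolev inequalities are stable under convolution, and the constants add up. -/
lemma PhiSobolevOn.conv {I : Set ℝ} {Φ ψ : ℝ → ℝ} (H : IsEntropyPair I Φ ψ) {ν₁ ν₂ : Measure ℝ}
    [IsProbabilityMeasure ν₁] [IsProbabilityMeasure ν₂] {C₁ C₂ : ℝ}
    (h₁ : PhiSobolevOn I Φ ψ ν₁ C₁) (h₂ : PhiSobolevOn I Φ ψ ν₂ C₂) (hC₁ : 0 ≤ C₁) :
    PhiSobolevOn I Φ ψ (ν₁ ∗ ν₂) (C₁ + C₂) := by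
  have hid : ¬ Bornology.IsBounded I → Integrable (fun x => x) (ν₁ ∗ ν₂) := by
    intro hI
    rw [integrable_conv_iff (by fun_prop)]
    have i1 := h₁.integrable_id hI
    have i2 := h₂.integrable_id hI
    refine ⟨Eventually.of_forall fun y => (integrable_const y).add i2, ?_⟩
    refine (i1.abs.add (integrable_const (∫ z, |z| ∂ν₂))).mono'
      (StronglyMeasurable.integral_prod_right' (f := fun p : ℝ × ℝ => ‖p.1 + p.2‖)
        (Continuous.stronglyMeasurable (by fun_prop))).aestronglyMeasurable
      (Eventually.of_forall fun y => ?_)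
    rw [Real.norm_of_nonneg (integral_nonneg fun z => norm_nonneg _)]
    have : ∫ z, ‖y + z‖ ∂ν₂ ≤ ∫ z, (|y| + |z|) ∂ν₂ :=
      integral_mono ((integrable_const y).add i2).norm ((integrable_const _).add i2.abs)
        fun z => abs_add_le y z
    rw [integral_add (integrable_const _) i2.abs] at this
    simpa using this
  have shift : ∀ f : ℝ → ℝ, ContDiff ℝ 1 f → ∀ y, ContDiff ℝ 1 fun z => f (y + z) :=
    fun f hf y => hf.comp (contDiff_const.add contDiff_id)
  have shift' : ∀ (f : ℝ → ℝ) (y z : ℝ), deriv (fun z => f (y + z)) z = deriv f (y + z) :=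
    fun f y z => deriv_comp_const_add f y z
  have hint2 : ∀ f : ℝ → ℝ, ContDiff ℝ 1 f → (∀ x, f x ∈ I) →
      (∃ L : ℝ, ∀ x, |deriv f x| ≤ L) → ∀ y, Integrable (fun z => f (y + z)) ν₂ := by
    rintro f hf hfI ⟨L, hL⟩ y
    exact integrable_of_isBounded_or_integrable_id h₂.integrable_id
      (lipschitzWith_of_abs_deriv_le (shift f hf y) (L := L) fun z => by
        rw [shift']; exact hL _) fun z => hfI _
  have hFI : ∀ f : ℝ → ℝ, ContDiff ℝ 1 f → (∀ x, f x ∈ I) →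
      (∃ L : ℝ, ∀ x, |deriv f x| ≤ L) → ∀ y, ∫ z, f (y + z) ∂ν₂ ∈ I :=
    fun f hf hfI hL y => H.convex.integral_mem H.closed
      (Eventually.of_forall fun z => hfI _) (hint2 f hf hfI hL y)
  have hF : ∀ f : ℝ → ℝ, ContDiff ℝ 1 f → (∀ x, f x ∈ I) →
      (∃ L : ℝ, ∀ x, |deriv f x| ≤ L) →
      ContDiff ℝ 1 (fun y => ∫ z, f (y + z) ∂ν₂) ∧
      (∀ y, deriv (fun y => ∫ z, f (y + z) ∂ν₂) y = ∫ z, deriv f (y + z) ∂ν₂) ∧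
      ∃ L : ℝ, ∀ y, |deriv (fun y => ∫ z, f (y + z) ∂ν₂) y| ≤ L := by
    intro f hf hfI hL
    obtain ⟨L, hL'⟩ := id hL
    obtain ⟨hF1, hF2⟩ := contDiff_integral_add (ν := ν₂) hf hL' (hint2 f hf hfI hL)
    refine ⟨hF1, hF2, L, fun y => ?_⟩
    rw [hF2]
    simpa using norm_integral_le_of_norm_le_const (μ := ν₂) (f := fun z => deriv f (y + z))
      (Eventually.of_forall fun z => hL' (y + z))
  have hent2 : ∀ f : ℝ → ℝ, ContDiff ℝ 1 f → (∀ x, f x ∈ I) →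
      (∃ L : ℝ, ∀ x, |deriv f x| ≤ L) → ∀ y, Integrable (fun z => Φ (f (y + z))) ν₂ ∧
      (∫ z, Φ (f (y + z)) ∂ν₂) - Φ (∫ z, f (y + z) ∂ν₂) ≤
        C₂ * ∫ z, ψ (f (y + z)) * |deriv f (y + z)| ^ 2 ∂ν₂ := by
    intro f hf hfI hL y
    have hL' : ∃ L : ℝ, ∀ z, |deriv (fun z => f (y + z)) z| ≤ L := by
      obtain ⟨L, hL⟩ := hL
      exact ⟨L, fun z => by rw [shift']; exact hL _⟩
    refine ⟨h₂.integrable_comp _ (shift f hf y) (fun z => hfI _) hL', ?_⟩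
    have := h₂.entropy_le _ (shift f hf y) (fun z => hfI _) hL'
    simp only [shift'] at this
    exact this
  have hcomp : ∀ f : ℝ → ℝ, ContDiff ℝ 1 f → (∀ x, f x ∈ I) →
      (∃ L : ℝ, ∀ x, |deriv f x| ≤ L) → Integrable (fun x => Φ (f x)) (ν₁ ∗ ν₂) := by
    intro f hf hfI hL
    obtain ⟨B, hB⟩ := H.exists_quad_le hfI hL
    obtain ⟨a, b, hab⟩ := H.exists_affine_le
    obtain ⟨hF1, -, hF3⟩ := hF f hf hfI hL
    have hcont : Continuous fun x => Φ (f x) := H.continuous_comp hf.continuous hfI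
    have hfconv : Integrable f (ν₁ ∗ ν₂) := by
      obtain ⟨L, hL⟩ := hL
      exact integrable_of_isBounded_or_integrable_id hid (lipschitzWith_of_abs_deriv_le hf hL) hfI
    have hlin : Integrable (fun x => a + b * f x) (ν₁ ∗ ν₂) :=
      (integrable_const a).add (hfconv.const_mul b)
    have hlin2 : ∀ y, Integrable (fun z => a + b * f (y + z)) ν₂ := fun y =>
      (integrable_const a).add ((hint2 f hf hfI hL y).const_mul b)
    rw [integrable_conv_iff hlin.aestronglyMeasurable] at hlin
    rw [integrable_conv_iff hcont.measurable.aestronglyMeasurable]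
    refine ⟨Eventually.of_forall fun y => (hent2 f hf hfI hL y).1, ?_⟩
    refine (((h₁.integrable_comp _ hF1 (hFI f hf hfI hL) hF3).add
      (integrable_const (|C₂| * B))).add (hlin.2.const_mul 2)).mono'
      (StronglyMeasurable.integral_prod_right' (f := fun p : ℝ × ℝ => ‖Φ (f (p.1 + p.2))‖)
        (Continuous.stronglyMeasurable
          (hcont.comp (continuous_fst.add continuous_snd)).norm)).aestronglyMeasurable
      (Eventually.of_forall fun y => ?_)
    rw [Real.norm_of_nonneg (integral_nonneg fun z => norm_nonneg _)]
    obtain ⟨hi, he⟩ := hent2 f hf hfI hL y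
    have hle : ∫ z, ‖Φ (f (y + z))‖ ∂ν₂ ≤
        ∫ z, (Φ (f (y + z)) + 2 * ‖a + b * f (y + z)‖) ∂ν₂ := by
      refine integral_mono hi.norm (hi.add ((hlin2 y).norm.const_mul 2)) fun z => ?_
      have := hab _ (hfI (y + z))
      simp only [Real.norm_eq_abs]
      rcases abs_cases (Φ (f (y + z))) with h | h <;>
        rcases abs_cases (a + b * f (y + z)) with h' | h' <;> linarith
    rw [integral_add hi ((hlin2 y).norm.const_mul 2), integral_const_mul] at hle
    have hq : |C₂ * ∫ z, ψ (f (y + z)) * |deriv f (y + z)| ^ 2 ∂ν₂| ≤ |C₂| * B := by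
      rw [abs_mul]
      refine mul_le_mul_of_nonneg_left ?_ (abs_nonneg _)
      simpa using norm_integral_le_of_norm_le_const (μ := ν₂)
        (f := fun z => ψ (f (y + z)) * |deriv f (y + z)| ^ 2)
        (Eventually.of_forall fun z => hB (y + z))
    have := (abs_le.1 hq).2
    simp only [Pi.add_apply]
    linarith
  refine ⟨hid, hcomp, fun f hf hfI hL => ?_⟩
  obtain ⟨hF1, hF2, hF3⟩ := hF f hf hfI hL
  have hFI' := hFI f hf hfI hL
  have hfconv : Integrable f (ν₁ ∗ ν₂) := by
    obtain ⟨L, hL⟩ := hL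
    exact integrable_of_isBounded_or_integrable_id hid (lipschitzWith_of_abs_deriv_le hf hL) hfI
  have hΦconv := hcomp f hf hfI hL
  have hqconv := H.integrable_quad hf hfI hL (ν₁ ∗ ν₂)
  have hΦF := h₁.integrable_comp _ hF1 hFI' hF3
  have hE1 := h₁.entropy_le _ hF1 hFI' hF3
  have hconvint : ∀ {g : ℝ → ℝ}, Integrable g (ν₁ ∗ ν₂) →
      Integrable (fun y => ∫ z, g (y + z) ∂ν₂) ν₁ := by
    intro g hg
    have hg' : Integrable (fun p : ℝ × ℝ => g (p.1 + p.2)) (ν₁.prod ν₂) := by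
      rw [Measure.conv] at hg
      exact hg.comp_measurable (by fun_prop)
    exact hg'.integral_prod_left
  have hqF := H.integrable_quad hF1 hFI' hF3 ν₁
  have hJ : ∫ y, ψ (∫ z, f (y + z) ∂ν₂) * |deriv (fun y => ∫ z, f (y + z) ∂ν₂) y| ^ 2 ∂ν₁ ≤
      ∫ y, ∫ z, ψ (f (y + z)) * |deriv f (y + z)| ^ 2 ∂ν₂ ∂ν₁ := by
    refine integral_mono hqF (hconvint hqconv) fun y => ?_
    have hi1 := hint2 f hf hfI hL y
    have hi2 : Integrable (fun z => deriv f (y + z)) ν₂ := by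
      obtain ⟨L, hL⟩ := hL
      have := hf.continuous_deriv le_rfl
      exact Integrable.of_bound (by fun_prop) L (Eventually.of_forall fun z => hL (y + z))
    have hi3 : Integrable (fun z => ψ (f (y + z)) * |deriv f (y + z)| ^ 2) ν₂ := by
      obtain ⟨B, hB⟩ := H.exists_quad_le hfI hL
      have := H.continuous_quad hf hfI
      exact Integrable.of_bound
        (this.comp (continuous_const.add continuous_id)).measurable.aestronglyMeasurable B
        (Eventually.of_forall fun z => hB (y + z))
    have := H.convexOn_quad.map_integral_le (μ := ν₂) (f := fun z => (f (y + z), deriv f (y + z)))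
      ((H.continuousOn.comp continuousOn_fst fun p hp => hp.1).mul (continuousOn_snd.pow 2))
      (H.closed.prod isClosed_univ) (Eventually.of_forall fun z => ⟨hfI _, trivial⟩)
      (hi1.prodMk hi2) (by simpa [Function.comp_def] using hi3)
    rw [integral_pair hi1 hi2] at this
    simp only [hF2, sq_abs]
    exact this
  rw [integral_conv hfconv, integral_conv hΦconv, integral_conv hqconv]
  have hE2 : (∫ y, ∫ z, Φ (f (y + z)) ∂ν₂ ∂ν₁) - ∫ y, Φ (∫ z, f (y + z) ∂ν₂) ∂ν₁ ≤
      C₂ * ∫ y, ∫ z, ψ (f (y + z)) * |deriv f (y + z)| ^ 2 ∂ν₂ ∂ν₁ := by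
    rw [← integral_sub (hconvint hΦconv) hΦF, ← integral_const_mul]
    exact integral_mono ((hconvint hΦconv).sub hΦF) ((hconvint hqconv).const_mul C₂)
      fun y => (hent2 f hf hfI hL y).2
  have := mul_le_mul_of_nonneg_left hJ hC₁
  linarith

/-- `Φ`-Sobolev inequalities for finite sums of independent random variables. -/
lemma PhiSobolevOn.map_sum {I : Set ℝ} {Φ ψ : ℝ → ℝ} (H : IsEntropyPair I Φ ψ) {ι Ω : Type*}
    [MeasurableSpace Ω] {P : Measure Ω} [IsProbabilityMeasure P] {X : ι → Ω → ℝ}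
    (hX : iIndepFun X P) (hXm : ∀ i, Measurable (X i)) {C : ι → ℝ} (hC : ∀ i, 0 ≤ C i)
    (h : ∀ i, PhiSobolevOn I Φ ψ (P.map (X i)) (C i)) (s : Finset ι) :
    PhiSobolevOn I Φ ψ (P.map (∑ i ∈ s, X i)) (∑ i ∈ s, C i) := by
  classical
  induction s using Finset.induction_on with
  | empty =>
    have : P.map (0 : Ω → ℝ) = Measure.dirac 0 := by
      rw [show (0 : Ω → ℝ) = fun _ => 0 from rfl, Measure.map_const, measure_univ, one_smul]
    simpa [this] using PhiSobolevOn.dirac_zero I Φ ψ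
  | insert i s hi ih =>
    have hm : Measurable (∑ j ∈ s, X j) := by
      simpa [Finset.sum_fn] using Finset.measurable_sum s fun j _ => hXm j
    rw [Finset.sum_insert hi, Finset.sum_insert hi, add_comm (X i), add_comm (C i),
      (hX.indepFun_finsetSum_of_notMem hXm hi).map_add_eq_map_conv_map hm (hXm i)]
    have := Measure.isProbabilityMeasure_map (μ := P) hm.aemeasurable
    have := Measure.isProbabilityMeasure_map (μ := P) (hXm i).aemeasurable
    exact ih.conv H (h i) (Finset.sum_nonneg fun j _ => hC j)

lemma norm_gradient_comp_sq_le {E : Type*} [NormedAddCommGroup E] [InnerProductSpace ℝ E]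
    [CompleteSpace E] {f : ℝ → ℝ} (hf : Differentiable ℝ f) {Θ : E → ℝ} {a : ℝ} (ha : 0 ≤ a)
    (hΘ : ∀ x y, dist (Θ x) (Θ y) ≤ Real.sqrt a * dist x y) (x : E) :
    ‖gradient (fun x => f (Θ x)) x‖ ^ 2 ≤ a * |deriv f (Θ x)| ^ 2 := by
  have hcont : Continuous Θ := by
    refine (LipschitzWith.of_dist_le_mul (K := (Real.sqrt a).toNNReal) fun x y => ?_).continuous
    rw [Real.coe_toNNReal _ (Real.sqrt_nonneg a)]
    exact hΘ x y
  have hle : ‖gradient (fun x => f (Θ x)) x‖ ≤ |deriv f (Θ x)| * Real.sqrt a := by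
    rw [gradient, LinearIsometryEquiv.norm_map]
    have key : ∀ ε : ℝ, 0 < ε →
        ‖fderiv ℝ (fun x => f (Θ x)) x‖ ≤ (|deriv f (Θ x)| + ε) * Real.sqrt a := by
      intro ε hε
      refine norm_fderiv_le_of_lip' ℝ (by positivity) ?_
      have h1 := (hasDerivAt_iff_isLittleO.1 (hf (Θ x)).hasDerivAt).def hε
      filter_upwards [hcont.continuousAt.eventually h1] with y hy
      have h2 : ‖Θ y - Θ x‖ ≤ Real.sqrt a * ‖y - x‖ := by
        simpa [dist_eq_norm] using hΘ y x
      calc ‖f (Θ y) - f (Θ x)‖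
          = ‖(f (Θ y) - f (Θ x) - (Θ y - Θ x) • deriv f (Θ x)) +
              (Θ y - Θ x) • deriv f (Θ x)‖ := by rw [sub_add_cancel]
        _ ≤ ε * ‖Θ y - Θ x‖ + ‖Θ y - Θ x‖ * |deriv f (Θ x)| := by
            refine (norm_add_le _ _).trans (add_le_add hy ?_)
            rw [norm_smul, Real.norm_eq_abs (deriv f (Θ x))]
        _ = (|deriv f (Θ x)| + ε) * ‖Θ y - Θ x‖ := by ring
        _ ≤ (|deriv f (Θ x)| + ε) * (Real.sqrt a * ‖y - x‖) := by gcongr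
        _ = (|deriv f (Θ x)| + ε) * Real.sqrt a * ‖y - x‖ := by ring
    have hlim : Tendsto (fun ε : ℝ => (|deriv f (Θ x)| + ε) * Real.sqrt a) (𝓝[>] 0)
        (𝓝 ((|deriv f (Θ x)| + 0) * Real.sqrt a)) :=
      ((continuous_const.add continuous_id).mul continuous_const).continuousAt.tendsto.mono_left
        nhdsWithin_le_nhds
    rw [add_zero] at hlim
    exact ge_of_tendsto hlim (by filter_upwards [self_mem_nhdsWithin] with ε hε using key ε hε)
  calc ‖gradient (fun x => f (Θ x)) x‖ ^ 2 ≤ (|deriv f (Θ x)| * Real.sqrt a) ^ 2 :=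
        pow_le_pow_left₀ (norm_nonneg _) hle 2
    _ = a * |deriv f (Θ x)| ^ 2 := by rw [mul_pow, Real.sq_sqrt ha]; ring

lemma norm_gradient_le_of_lipschitzWith {E : Type*} [NormedAddCommGroup E] [InnerProductSpace ℝ E]
    [CompleteSpace E] {g : E → ℝ} {K : NNReal} (hg : LipschitzWith K g) (x : E) :
    ‖gradient g x‖ ≤ K := by
  rw [gradient, LinearIsometryEquiv.norm_map]
  exact norm_fderiv_le_of_lipschitz ℝ hg

section LipschitzImage

variable {E : Type*} [NormedAddCommGroup E] [InnerProductSpace ℝ E] [CompleteSpace E]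
  [MeasurableSpace E] {I : Set ℝ} {Φ ψ : ℝ → ℝ} {μ : Measure E} [IsProbabilityMeasure μ] {c : ℝ}

/-- A gradient `Φ`-Sobolev inequality bounds the `Φ`-entropy by the squared Lipschitz constant. -/
lemma IsEntropyPair.entropy_le_lipschitz (H : IsEntropyPair I Φ ψ) (hc : 0 ≤ c)
    (hμ : ∀ g : E → ℝ, (∃ K : NNReal, LipschitzWith K g) → (∀ x, g x ∈ I) →
      (∫ x, Φ (g x) ∂μ) - Φ (∫ x, g x ∂μ) ≤ c * ∫ x, ψ (g x) * ‖gradient g x‖ ^ 2 ∂μ) :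
    ∃ C, ∀ (K : NNReal) (g : E → ℝ), LipschitzWith K g → (∀ x, g x ∈ I) →
      (∫ x, Φ (g x) ∂μ) - Φ (∫ x, g x ∂μ) ≤ C * (K : ℝ) ^ 2 := by
  obtain ⟨B, hB0, hB⟩ := H.exists_forall_le
  refine ⟨c * B, fun K g hg hgI => (hμ g ⟨K, hg⟩ hgI).trans ?_⟩
  rw [mul_assoc]
  refine mul_le_mul_of_nonneg_left ?_ hc
  have := integral_mono_of_nonneg (μ := μ) (f := fun x => ψ (g x) * ‖gradient g x‖ ^ 2)
    (g := fun _ => B * (K : ℝ) ^ 2)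
    (Eventually.of_forall fun x => mul_nonneg (H.nonneg _ (hgI x)) (by positivity))
    (integrable_const _) (Eventually.of_forall fun x =>
      mul_le_mul (hB _ (hgI x)) (pow_le_pow_left₀ (norm_nonneg _)
        (norm_gradient_le_of_lipschitzWith hg x) 2) (by positivity) hB0)
  simpa using this

/-- `Φ`-Sobolev inequalities are preserved by Lipschitz images. -/
lemma PhiSobolevOn.map_lipschitz [BorelSpace E] (H : IsEntropyPair I Φ ψ) (hc : 0 ≤ c)
    (hμ : ∀ g : E → ℝ, (∃ K : NNReal, LipschitzWith K g) → (∀ x, g x ∈ I) →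
      (∫ x, Φ (g x) ∂μ) - Φ (∫ x, g x ∂μ) ≤ c * ∫ x, ψ (g x) * ‖gradient g x‖ ^ 2 ∂μ)
    (hint : ¬ Bornology.IsBounded I → ∀ (K : NNReal) (g : E → ℝ), LipschitzWith K g →
      Integrable g μ)
    {a : ℝ} (ha : 0 ≤ a) {Θ : E → ℝ}
    (hΘ : ∀ x y, dist (Θ x) (Θ y) ≤ Real.sqrt a * dist x y) :
    PhiSobolevOn I Φ ψ (μ.map Θ) (c * a) := by
  have hΘL : LipschitzWith (Real.sqrt a).toNNReal Θ := by
    refine LipschitzWith.of_dist_le_mul fun x y => ?_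
    rw [Real.coe_toNNReal _ (Real.sqrt_nonneg a)]
    exact hΘ x y
  have hΘm : AEMeasurable Θ μ := hΘL.continuous.measurable.aemeasurable
  obtain ⟨C, hE⟩ := H.entropy_le_lipschitz hc hμ
  have hid : ¬ Bornology.IsBounded I → Integrable (fun x => x) (μ.map Θ) := fun hI =>
    (integrable_map_measure (by fun_prop) hΘm).2 (hint hI _ Θ hΘL)
  have := Measure.isProbabilityMeasure_map hΘm
  refine ⟨hid, ?_, ?_⟩
  · rintro f hf hfI ⟨L, hL⟩
    have hfL := lipschitzWith_of_abs_deriv_le hf hL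
    have hfi : Integrable f (μ.map Θ) := integrable_of_isBounded_or_integrable_id hid hfL hfI
    rw [integrable_map_measure hfi.aestronglyMeasurable hΘm] at hfi
    exact (integrable_map_measure
      (H.continuous_comp hf.continuous hfI).measurable.aestronglyMeasurable hΘm).2
      (H.integrable_comp hE (hfL.comp hΘL) (fun x => hfI _) hfi)
  · intro f hf hfI hL
    have hq := H.integrable_quad hf hfI hL (μ.map Θ)
    have hΦf := H.continuous_comp hf.continuous hfI
    rw [integral_map hΘm hΦf.measurable.aestronglyMeasurable,
      integral_map hΘm hf.continuous.measurable.aestronglyMeasurable,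
      integral_map hΘm hq.aestronglyMeasurable, mul_assoc]
    rw [integrable_map_measure hq.aestronglyMeasurable hΘm] at hq
    obtain ⟨L, hL⟩ := hL
    have hfL := lipschitzWith_of_abs_deriv_le hf hL
    refine (hμ (fun x => f (Θ x)) ⟨_, hfL.comp hΘL⟩ fun x => hfI _).trans
      (mul_le_mul_of_nonneg_left ?_ hc)
    rw [← integral_const_mul]
    refine integral_mono_of_nonneg
      (Eventually.of_forall fun x => mul_nonneg (H.nonneg _ (hfI _)) (by positivity))
      (hq.const_mul a) (Eventually.of_forall fun x => ?_)
    have := mul_le_mul_of_nonneg_left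
      (norm_gradient_comp_sq_le (hf.differentiable one_ne_zero) ha hΘ x) (H.nonneg _ (hfI (Θ x)))
    linarith

end LipschitzImage

lemma integral_affine_of_not_integrable {Ω : Type*} [MeasurableSpace Ω] {μ : Measure Ω}
    [IsProbabilityMeasure μ] {g : Ω → ℝ} (hg : ¬ Integrable g μ) (a b : ℝ) :
    ∫ x, a + b * g x ∂μ = if b = 0 then a else 0 := by
  split_ifs with hb
  · simp [hb]
  · refine integral_undef fun h => hg ?_
    have := (h.sub (integrable_const a)).const_mul b⁻¹
    refine this.congr (Eventually.of_forall fun x => ?_)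
    simp only [Pi.sub_apply]
    field_simp
    ring

/-- **Φ-Sobolev inequality for convolutions of Lipschitz images.** Under `(H1)`, if each
probability measure `μ_i` on `ℝ^{d_i}` satisfies a Φ-Sobolev inequality with constant `c_i`
for Lipschitz functions, and `Θ_i : ℝ^{d_i} → ℝ` is Lipschitz with constant at most `√α_i`,
then the measure `μ = (Θ_1·μ_1) * ⋯ * (Θ_n·μ_n)` (pushforward of the product measure under
`x ↦ Θ_1(x_1) + ⋯ + Θ_n(x_n)`) satisfies a Φ-Sobolev inequality with constant
`c_1 α_1 + ⋯ + c_n α_n`. -/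
theorem phiSobolev_sum_lipschitz_images
    {n : ℕ} (d : Fin n → ℕ)
    (I : Set ℝ) (hI : Convex ℝ I) (hIc : IsClosed I)
    (Φ : ℝ → ℝ) (hΦ : ContDiffOn ℝ 2 Φ I) (hΦconv : ConvexOn ℝ I Φ)
    (hH1nonneg : ∀ u ∈ I, ∀ v : ℝ, 0 ≤ deriv (deriv Φ) u * v ^ 2)
    (hH1conv : ConvexOn ℝ (I ×ˢ (Set.univ : Set ℝ))
      (fun p : ℝ × ℝ => deriv (deriv Φ) p.1 * p.2 ^ 2))
    (μ : ∀ i : Fin n, Measure (EuclideanSpace ℝ (Fin (d i))))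
    [∀ i, IsProbabilityMeasure (μ i)]
    (c : Fin n → ℝ) (hc : ∀ i, 0 < c i)
    (hμ : ∀ i, ∀ g : EuclideanSpace ℝ (Fin (d i)) → ℝ,
      (∃ K : NNReal, LipschitzWith K g) → (∀ x, g x ∈ I) →
      (∫ x, Φ (g x) ∂(μ i)) - Φ (∫ x, g x ∂(μ i))
        ≤ c i * ∫ x, deriv (deriv Φ) (g x) * ‖gradient g x‖ ^ 2 ∂(μ i))
    (α : Fin n → ℝ) (hα : ∀ i, 0 < α i)
    (Θ : ∀ i : Fin n, EuclideanSpace ℝ (Fin (d i)) → ℝ)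
    (hΘ : ∀ i, ∀ x y, dist (Θ i x) (Θ i y) ≤ Real.sqrt (α i) * dist x y)
    (ν : Measure ℝ)
    (hν : ν = (Measure.pi μ).map (fun x => ∑ i, Θ i (x i))) :
    ∀ f : ℝ → ℝ, ContDiff ℝ 1 f → (∀ x, f x ∈ I) →
      (∃ C : ℝ, ∀ x, |deriv f x| ≤ C) →
      (∫ y, Φ (f y) ∂ν) - Φ (∫ y, f y ∂ν)
        ≤ (∑ i, c i * α i) * ∫ y, deriv (deriv Φ) (f y) * |deriv f y| ^ 2 ∂ν := by
  have hΘm : ∀ i, Measurable (Θ i) := by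
    intro i
    refine (LipschitzWith.of_dist_le_mul (K := (Real.sqrt (α i)).toNNReal)
      fun x y => ?_).continuous.measurable
    rw [Real.coe_toNNReal _ (Real.sqrt_nonneg _)]
    exact hΘ i x y
  rintro f hf hfI hL
  rcases (interior I).eq_empty_or_nonempty with hIn | hIn
  · have hd : ∀ y, deriv f y = 0 := fun y =>
      deriv_eq_zero_of_notMem_interior hI hfI (by simp [hIn])
    have hconst : f = fun _ => f 0 := funext fun y =>
      is_const_of_deriv_eq_zero (hf.differentiable one_ne_zero) hd y 0
    have hm : Measurable fun x : ∀ i, EuclideanSpace ℝ (Fin (d i)) => ∑ i, Θ i (x i) :=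
      Finset.measurable_sum _ fun i _ => (hΘm i).comp (measurable_pi_apply i)
    have := Measure.isProbabilityMeasure_map (μ := Measure.pi μ) hm.aemeasurable
    rw [← hν] at this
    rw [hconst]
    simp
  obtain ⟨ψ, H, hψ⟩ := IsEntropyPair.of_contDiffOn hI hIc hIn hΦ hΦconv hH1nonneg hH1conv
  have hμ' : ∀ i, ∀ g : EuclideanSpace ℝ (Fin (d i)) → ℝ,
      (∃ K : NNReal, LipschitzWith K g) → (∀ x, g x ∈ I) →
      (∫ x, Φ (g x) ∂(μ i)) - Φ (∫ x, g x ∂(μ i))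
        ≤ c i * ∫ x, ψ (g x) * ‖gradient g x‖ ^ 2 ∂(μ i) := by
    intro i g hg hgI
    have : ∀ x, deriv (deriv Φ) (g x) * ‖gradient g x‖ ^ 2 = ψ (g x) * ‖gradient g x‖ ^ 2 := by
      intro x
      by_cases hx : g x ∈ interior I
      · rw [hψ _ hx]
      · simp [gradient, fderiv_eq_zero_of_notMem_interior hI hgI hx]
    simpa only [this] using hμ i g hg hgI
  have hfψ : ∀ y, deriv (deriv Φ) (f y) * |deriv f y| ^ 2 = ψ (f y) * |deriv f y| ^ 2 := by
    intro y
    by_cases hy : f y ∈ interior I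
    · rw [hψ _ hy]
    · simp [deriv_eq_zero_of_notMem_interior hI hfI hy]
  simp only [hfψ]
  set X : Fin n → (∀ i, EuclideanSpace ℝ (Fin (d i))) → ℝ := fun i x => Θ i (x i) with hXdef
  have hXm : ∀ i, Measurable (X i) := fun i => (hΘm i).comp (measurable_pi_apply i)
  have hν' : ν = (Measure.pi μ).map (∑ i, X i) := by
    rw [hν]
    congr 1
    ext x
    simp [hXdef]
  have hνp : IsProbabilityMeasure ν := by
    rw [hν']
    refine Measure.isProbabilityMeasure_map (Measurable.aemeasurable ?_)
    simpa [Finset.sum_fn] using Finset.measurable_sum Finset.univ fun i _ => hXm i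
  by_cases hint : ¬ Bornology.IsBounded I → ∀ i, ∀ (K : NNReal)
      (g : EuclideanSpace ℝ (Fin (d i)) → ℝ), LipschitzWith K g → Integrable g (μ i)
  · have hS : ∀ i, PhiSobolevOn I Φ ψ ((Measure.pi μ).map (X i)) (c i * α i) := by
      intro i
      have hXi : (Measure.pi μ).map (X i) = (μ i).map (Θ i) := by
        rw [← (measurePreserving_eval μ i).map_eq,
          Measure.map_map (hΘm i) (measurable_pi_apply i)]
        rfl
      rw [hXi]
      exact PhiSobolevOn.map_lipschitz H (hc i).le (hμ' i) (fun h => hint h i) (hα i).le (hΘ i)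
    have := PhiSobolevOn.map_sum H (iIndepFun_pi fun i => (hΘm i).aemeasurable) hXm
      (fun i => (mul_pos (hc i) (hα i)).le) hS Finset.univ
    rw [← hν'] at this
    exact this.entropy_le f hf hfI hL
  · push Not at hint
    obtain ⟨hIb, i, K, g, hg, hgint⟩ := hint
    obtain ⟨C, hE⟩ := H.entropy_le_lipschitz (hc i).le (hμ' i)
    have hzero : ∀ u ∈ I, ψ u = 0 := by
      by_contra hcon
      exact hgint (H.integrable_of_lipschitz hE hIb hcon hg)
    obtain ⟨a, b, hab⟩ := H.affine_of_eq_zero hzero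
    have hΦf : ∀ y, Φ (f y) = a + b * f y := fun y => hab _ (hfI y)
    simp only [hΦf, hzero _ (hfI _), zero_mul, integral_zero, mul_zero]
    by_cases hfint : Integrable f ν
    · rw [hab _ (hI.integral_mem hIc (Eventually.of_forall hfI) hfint),
        integral_add (integrable_const a) (hfint.const_mul b), integral_const_mul]
      simp
    · obtain ⟨p, hp⟩ := hIn
      obtain ⟨s, hs, hray⟩ := exists_ray_mem hI hIb (interior_subset hp)
      have hgI : ∀ x, p + s * |g x| ∈ I := fun x => hray _ (abs_nonneg _)
      have hgL : LipschitzWith K fun x => p + s * |g x| := by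
        refine LipschitzWith.of_dist_le_mul fun x y => ?_
        have hs1 : |s| = 1 := by
          rcases mul_self_eq_one_iff.1 hs with h | h <;> simp [h]
        rw [Real.dist_eq, add_sub_add_left_eq_sub, ← mul_sub, abs_mul, hs1, one_mul]
        exact (abs_abs_sub_abs_le_abs_sub (g x) (g y)).trans (hg.dist_le_mul x y)
      have hgn : ¬ Integrable (fun x => p + s * |g x|) (μ i) := by
        intro h
        refine hgint (((h.sub (integrable_const p)).const_mul s).mono'
          hg.continuous.measurable.aestronglyMeasurable (Eventually.of_forall fun x => ?_))
        simp only [Pi.sub_apply, Real.norm_eq_abs]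
        linear_combination (-|g x|) * hs
      have := hμ' i _ ⟨K, hgL⟩ hgI
      simp only [hab _ (hgI _), hzero _ (hgI _), zero_mul, integral_zero, mul_zero] at this
      rw [integral_affine_of_not_integrable hgn, integral_undef hgn] at this
      rw [integral_affine_of_not_integrable hfint, integral_undef hfint]
      exact this
end

section
/- Let I ⊆ ℝ be a closed interval with nonempty interior and Φ : I → ℝ a smooth convex function, and suppose there exists a point a in the interior of I with Φ''(a) > 0. Let μ be a probability measure on ℝ^d and c > 0 be such that for every smooth bounded function f : ℝ^d → I with bounded gradient, Ent_μ^Φ(f) ≤ c · ∫ Φ''(f) · ‖∇f‖² dμ. Then for every p ∈ (1, 2] and every smooth bounded function g : ℝ^d → (0,∞) with bounded gradient and with inf g > 0, one has ∫ g^p dμ − (∫ g dμ)^p ≤ (2cp/(p−1)) · ∫ p(p−1) · g^{p−2} · ‖∇g‖² dμ. -/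
open MeasureTheory

/-- A `C²` function `Φ` with `Φ''(a) > 0` is bounded near `a`, has `0 ≤ Φ'' ≤ (3/2) Φ''(a)` there,
and lies above its tangent at `a` plus half of the quadratic Taylor term. -/
lemma exists_ball_quadratic_bounds {Φ : ℝ → ℝ} {U : Set ℝ} (hU : IsOpen U)
    (hΦ : ContDiffOn ℝ 2 Φ U) {a : ℝ} (ha : a ∈ U) (ha' : 0 < deriv (deriv Φ) a) :
    ∃ r > 0, Metric.ball a r ⊆ U ∧ ∀ x ∈ Metric.ball a r,
      |Φ x| ≤ |Φ a| + 1 ∧ 0 ≤ deriv (deriv Φ) x ∧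
      deriv (deriv Φ) x ≤ 3 / 2 * deriv (deriv Φ) a ∧
      Φ a + deriv Φ a * (x - a) + deriv (deriv Φ) a / 4 * (x - a) ^ 2 ≤ Φ x := by
  set k := deriv (deriv Φ) a with hk
  have hΦ1 : ContDiffOn ℝ 1 (deriv Φ) U := hΦ.deriv_of_isOpen hU (by norm_num)
  have hΦ2 : ContDiffOn ℝ 0 (deriv (deriv Φ)) U := hΦ1.deriv_of_isOpen hU (by norm_num)
  have hd : ∀ x ∈ U, HasDerivAt Φ (deriv Φ x) x := fun x hx =>
    ((hΦ.differentiableOn (by norm_num)).differentiableAt (hU.mem_nhds hx)).hasDerivAt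
  have hd2 : ∀ x ∈ U, HasDerivAt (deriv Φ) (deriv (deriv Φ) x) x := fun x hx =>
    ((hΦ1.differentiableOn (by norm_num)).differentiableAt (hU.mem_nhds hx)).hasDerivAt
  have hc : ContinuousAt Φ a := (hd a ha).continuousAt
  have hc2 : ContinuousAt (deriv (deriv Φ)) a := hΦ2.continuousOn.continuousAt (hU.mem_nhds ha)
  have hev : ∀ᶠ x in nhds a, x ∈ U ∧ |Φ x| < |Φ a| + 1 ∧
      k / 2 < deriv (deriv Φ) x ∧ deriv (deriv Φ) x < 3 / 2 * k :=
    (hU.eventually_mem ha).and <| (hc.abs.eventually (gt_mem_nhds (by linarith))).and <|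
      (hc2.eventually (lt_mem_nhds (by rw [← hk]; linarith))).and
        (hc2.eventually (gt_mem_nhds (by rw [← hk]; linarith)))
  obtain ⟨r, hr, hball⟩ := Metric.eventually_nhds_iff_ball.1 hev
  refine ⟨r, hr, fun x hx => (hball x hx).1, fun x hx => ?_⟩
  obtain ⟨-, h1, h2, h3⟩ := hball x hx
  refine ⟨h1.le, by linarith, h3.le, ?_⟩
  set Ψ : ℝ → ℝ := fun x => Φ x - deriv Φ a * (x - a) - k / 4 * (x - a) ^ 2 with hΨ
  have hΨ1 : ∀ y ∈ Metric.ball a r,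
      HasDerivAt Ψ (deriv Φ y - deriv Φ a - k / 2 * (y - a)) y := fun y hy => by
    have e : HasDerivAt (fun y : ℝ => y - a) 1 y := (hasDerivAt_id y).sub_const a
    refine (((hd y (hball y hy).1).sub (e.const_mul (deriv Φ a))).sub
      ((e.pow 2).const_mul (k / 4))).congr_deriv ?_
    push_cast
    ring
  have hΨ2 : ∀ y ∈ Metric.ball a r, HasDerivAt (deriv Ψ) (deriv (deriv Φ) y - k / 2) y :=
    fun y hy => by
    have e : HasDerivAt (fun y : ℝ => y - a) 1 y := (hasDerivAt_id y).sub_const a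
    have h : HasDerivAt (fun y => deriv Φ y - deriv Φ a - k / 2 * (y - a))
        (deriv (deriv Φ) y - k / 2) y :=
      (((hd2 y (hball y hy).1).sub_const (deriv Φ a)).sub (e.const_mul (k / 2))).congr_deriv
        (by ring)
    refine h.congr_of_eventuallyEq ?_
    filter_upwards [Metric.isOpen_ball.mem_nhds hy] with z hz using (hΨ1 z hz).deriv
  have hconv : ConvexOn ℝ (Metric.ball a r) Ψ :=
    convexOn_of_deriv2_nonneg' (convex_ball a r)
      (fun y hy => (hΨ1 y hy).differentiableAt.differentiableWithinAt)
      (fun y hy => (hΨ2 y hy).differentiableAt.differentiableWithinAt)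
      (fun y hy => by
        simp only [Function.iterate_succ, Function.iterate_zero, Function.comp_apply, id]
        rw [(hΨ2 y hy).deriv]
        linarith [(hball y hy).2.2.1])
  have haB : a ∈ Metric.ball a r := Metric.mem_ball_self hr
  have hmin : IsMinOn Ψ (Metric.ball a r) a := by
    refine hconv.isMinOn_of_rightDeriv_eq_zero (by rwa [Metric.isOpen_ball.interior_eq]) ?_
    have := (hΨ1 a haB).hasDerivWithinAt (s := Set.Ioi a)
    rw [this.derivWithin (uniqueDiffWithinAt_Ioi a)]
    ring
  have := hmin hx
  simp only [hΨ, Set.mem_ofPred_eq] at this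
  linarith

lemma norm_gradient_eq_norm_fderiv {E : Type*} [NormedAddCommGroup E] [InnerProductSpace ℝ E]
    [CompleteSpace E] (f : E → ℝ) (x : E) : ‖gradient f x‖ = ‖fderiv ℝ f x‖ := by
  simp [gradient]

/-- A Φ-Sobolev inequality implies a Poincaré inequality, here with constant `6c`. -/
lemma poincare_of_phiSobolev {E : Type*} [NormedAddCommGroup E] [InnerProductSpace ℝ E]
    [CompleteSpace E] [MeasurableSpace E] [BorelSpace E] [SecondCountableTopology E]
    {I : Set ℝ} {Φ : ℝ → ℝ} (hΦ : ContDiffOn ℝ 2 Φ I)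
    {a : ℝ} (ha : a ∈ interior I) (ha' : 0 < deriv (deriv Φ) a)
    {μ : Measure E} [IsProbabilityMeasure μ] {c : ℝ} (hc : 0 ≤ c)
    (hμ : ∀ f : E → ℝ, ContDiff ℝ (⊤ : ℕ∞) f → (∀ x, f x ∈ I) →
      (∃ C : ℝ, ∀ x, |f x| ≤ C) → (∃ C : ℝ, ∀ x, ‖gradient f x‖ ≤ C) →
      (∫ x, Φ (f x) ∂μ) - Φ (∫ x, f x ∂μ)
        ≤ c * ∫ x, deriv (deriv Φ) (f x) * ‖gradient f x‖ ^ 2 ∂μ)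
    {h : E → ℝ} (hh : ContDiff ℝ (⊤ : ℕ∞) h) (hb : ∃ C : ℝ, ∀ x, |h x| ≤ C)
    (hg : ∃ C : ℝ, ∀ x, ‖fderiv ℝ h x‖ ≤ C) :
    (∫ x, h x ^ 2 ∂μ) - (∫ x, h x ∂μ) ^ 2 ≤ 6 * c * ∫ x, ‖fderiv ℝ h x‖ ^ 2 ∂μ := by
  obtain ⟨r, hr, hrI, hB⟩ := exists_ball_quadratic_bounds isOpen_interior
    (hΦ.mono interior_subset) ha ha'
  set k := deriv (deriv Φ) a
  obtain ⟨C, hC⟩ := hb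
  obtain ⟨D, hD⟩ := hg
  have hC0 : 0 ≤ C := (abs_nonneg _).trans (hC 0)
  have hhc : Continuous h := hh.continuous
  have hint : Integrable h μ := .of_bound hhc.aestronglyMeasurable C (ae_of_all _ hC)
  have hint2 : Integrable (fun x => h x ^ 2) μ :=
    .of_bound (hhc.pow 2).aestronglyMeasurable (C ^ 2) (ae_of_all _ fun x => by
      rw [Real.norm_eq_abs, abs_pow]
      exact pow_le_pow_left₀ (abs_nonneg _) (hC x) 2)
  have hfc : Continuous (fderiv ℝ h) := hh.continuous_fderiv (by simp)
  have hintD : Integrable (fun x => ‖fderiv ℝ h x‖ ^ 2) μ :=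
    .of_bound (hfc.norm.pow 2).aestronglyMeasurable (D ^ 2) (ae_of_all _ fun x => by
      rw [Real.norm_eq_abs, abs_pow, abs_norm]
      exact pow_le_pow_left₀ (norm_nonneg _) (hD x) 2)
  set m := ∫ x, h x ∂μ with hm
  have hmC : |m| ≤ C := by
    simpa using norm_integral_le_of_norm_le_const (μ := μ) (f := h) (ae_of_all _ hC)
  set ε := r / (2 * C + 1) with hε
  have hε0 : 0 < ε := by positivity
  set f : E → ℝ := fun x => a + ε * (h x - m) with hf
  have hfball : ∀ x, f x ∈ Metric.ball a r := fun x => by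
    have h1 : |h x - m| < 2 * C + 1 := by
      linarith [abs_sub (h x) m, hC x]
    rw [Metric.mem_ball, Real.dist_eq, hf]
    simp only [add_sub_cancel_left, abs_mul, abs_of_pos hε0]
    calc ε * |h x - m| < ε * (2 * C + 1) := by gcongr
      _ = r := by rw [hε]; field_simp
  have hfs : ContDiff ℝ (⊤ : ℕ∞) f := contDiff_const.add (contDiff_const.mul (hh.sub contDiff_const))
  have hfd : ∀ x, ‖gradient f x‖ = ε * ‖fderiv ℝ h x‖ := fun x => by
    have : HasFDerivAt f (ε • fderiv ℝ h x) x :=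
      ((((hh.differentiable (by simp)) x).hasFDerivAt.sub_const m).const_mul ε).const_add a
    rw [norm_gradient_eq_norm_fderiv, this.fderiv, norm_smul, Real.norm_of_nonneg hε0.le]
  have key := hμ f hfs (fun x => interior_subset (hrI (hfball x)))
    ⟨|a| + r, fun x => by
      have := hfball x
      rw [Metric.mem_ball, Real.dist_eq] at this
      linarith [abs_sub_abs_le_abs_sub (f x) a]⟩
    ⟨ε * D, fun x => by rw [hfd]; gcongr; exact hD x⟩
  have hzint : Integrable (fun x => h x - m) μ := hint.sub (integrable_const m)
  have hz : ∫ x, (h x - m) ∂μ = 0 := by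
    rw [integral_sub hint (integrable_const m)]
    simp [hm]
  have hintf : ∫ x, f x ∂μ = a := by
    simp only [hf]
    rw [integral_add (integrable_const a) (hzint.const_mul ε), integral_const_mul, hz]
    simp
  have hsq : (fun x => (h x - m) ^ 2) = fun x => h x ^ 2 - 2 * m * (h x - m) - m ^ 2 := by
    ext x; ring
  have hsqint : Integrable (fun x => h x ^ 2 - 2 * m * (h x - m)) μ :=
    hint2.sub (hzint.const_mul (2 * m))
  have hvint : Integrable (fun x => (h x - m) ^ 2) μ := by
    rw [hsq]
    exact hsqint.sub (integrable_const (m ^ 2))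
  have hvar : ∫ x, (h x - m) ^ 2 ∂μ = (∫ x, h x ^ 2 ∂μ) - m ^ 2 := by
    rw [hsq, integral_sub hsqint (integrable_const (m ^ 2)),
      integral_sub hint2 (hzint.const_mul (2 * m)), integral_const_mul, hz]
    simp
  have hΦf : Integrable (fun x => Φ (f x)) μ :=
    .of_bound ((hΦ.continuousOn.comp_continuous hfs.continuous
      (fun x => interior_subset (hrI (hfball x)))).aestronglyMeasurable) (|Φ a| + 1)
      (ae_of_all _ fun x => (hB _ (hfball x)).1)
  have hlow : Φ a + k / 4 * ε ^ 2 * ∫ x, (h x - m) ^ 2 ∂μ ≤ ∫ x, Φ (f x) ∂μ := by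
    have i1 : Integrable (fun x => Φ a + deriv Φ a * ε * (h x - m)) μ :=
      (integrable_const (Φ a)).add (hzint.const_mul (deriv Φ a * ε))
    have i2 : Integrable (fun x => k / 4 * ε ^ 2 * (h x - m) ^ 2) μ := hvint.const_mul _
    have e : ∫ x, (Φ a + deriv Φ a * ε * (h x - m)) + k / 4 * ε ^ 2 * (h x - m) ^ 2 ∂μ
        = Φ a + k / 4 * ε ^ 2 * ∫ x, (h x - m) ^ 2 ∂μ := by
      rw [integral_add i1 i2, integral_add (integrable_const (Φ a)) (hzint.const_mul _),
        integral_const_mul, integral_const_mul, hz]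
      simp
    rw [← e]
    refine integral_mono (i1.add i2) hΦf fun x => ?_
    have := (hB _ (hfball x)).2.2.2
    simp only [hf, add_sub_cancel_left] at this ⊢
    linarith
  have hup : ∫ x, deriv (deriv Φ) (f x) * ‖gradient f x‖ ^ 2 ∂μ
      ≤ 3 / 2 * k * ε ^ 2 * ∫ x, ‖fderiv ℝ h x‖ ^ 2 ∂μ := by
    rw [← integral_const_mul]
    refine integral_mono_of_nonneg (ae_of_all _ fun x => ?_) (hintD.const_mul _)
      (ae_of_all _ fun x => ?_)
    · exact mul_nonneg (hB _ (hfball x)).2.1 (sq_nonneg _)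
    · have := (hB _ (hfball x)).2.2.1
      simp only [hfd, mul_pow, ← mul_assoc]
      gcongr
  rw [hintf] at key
  rw [← hvar]
  have hfin := key.trans (mul_le_mul_of_nonneg_left hup hc)
  refine le_of_mul_le_mul_left (a := k / 4 * ε ^ 2) ?_ (by positivity)
  linarith

/-- **Φ-Sobolev implies the `x ↦ x^p` Sobolev inequalities.** If `Φ` is smooth convex on a
closed interval `I` with `Φ''(a) > 0` at some interior point `a`, and `μ` satisfies a
Φ-Sobolev inequality with constant `c` for smooth bounded functions with bounded gradient,
then for every `p ∈ (1,2]` and smooth bounded `g > 0` with bounded gradient and `inf g > 0`,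
`∫ g^p dμ − (∫ g dμ)^p ≤ (2cp/(p−1)) ∫ p(p−1) g^{p−2} ‖∇g‖² dμ`. -/
theorem phiSobolev_implies_pSobolev
    {d : ℕ}
    (I : Set ℝ) (hI : Convex ℝ I) (hIc : IsClosed I)
    (Φ : ℝ → ℝ) (hΦ : ContDiffOn ℝ (⊤ : ℕ∞) Φ I) (hΦconv : ConvexOn ℝ I Φ)
    (a : ℝ) (ha : a ∈ interior I) (ha' : 0 < deriv (deriv Φ) a)
    (μ : Measure (EuclideanSpace ℝ (Fin d))) [IsProbabilityMeasure μ]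
    (c : ℝ) (hc : 0 < c)
    (hμ : ∀ f : EuclideanSpace ℝ (Fin d) → ℝ, ContDiff ℝ (⊤ : ℕ∞) f → (∀ x, f x ∈ I) →
      (∃ C : ℝ, ∀ x, |f x| ≤ C) → (∃ C : ℝ, ∀ x, ‖gradient f x‖ ≤ C) →
      (∫ x, Φ (f x) ∂μ) - Φ (∫ x, f x ∂μ)
        ≤ c * ∫ x, deriv (deriv Φ) (f x) * ‖gradient f x‖ ^ 2 ∂μ) :
    ∀ p : ℝ, p ∈ Set.Ioc (1 : ℝ) 2 →
    ∀ g : EuclideanSpace ℝ (Fin d) → ℝ, ContDiff ℝ (⊤ : ℕ∞) g → (∀ x, 0 < g x) →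
      (∃ C : ℝ, ∀ x, g x ≤ C) → (∃ C : ℝ, ∀ x, ‖gradient g x‖ ≤ C) →
      (∃ ε : ℝ, 0 < ε ∧ ∀ x, ε ≤ g x) →
      (∫ x, g x ^ p ∂μ) - (∫ x, g x ∂μ) ^ p
        ≤ (2 * c * p / (p - 1))
            * ∫ x, p * (p - 1) * g x ^ (p - 2) * ‖gradient g x‖ ^ 2 ∂μ := by
  intro p ⟨hp1, hp2⟩ g hg hg0 ⟨C, hC⟩ ⟨D, hD⟩ ⟨ε, hε, hεg⟩
  have hgc : Continuous g := hg.continuous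
  have hfd : ∀ x, HasFDerivAt (fun x => g x ^ (p / 2))
      ((p / 2 * g x ^ (p / 2 - 1)) • fderiv ℝ g x) x := fun x =>
    ((hg.differentiable (by simp)) x).hasFDerivAt.rpow_const (.inl (hg0 x).ne')
  have hnorm : ∀ x, ‖fderiv ℝ (fun x => g x ^ (p / 2)) x‖ =
      p / 2 * g x ^ (p / 2 - 1) * ‖gradient g x‖ := fun x => by
    have := Real.rpow_nonneg (hg0 x).le (p / 2 - 1)
    rw [(hfd x).fderiv, norm_smul, norm_gradient_eq_norm_fderiv,
      Real.norm_of_nonneg (by positivity)]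
  have hbdd : ∀ x, |g x ^ (p / 2)| ≤ C ^ (p / 2) := fun x => by
    rw [abs_of_nonneg (Real.rpow_nonneg (hg0 x).le _)]
    exact Real.rpow_le_rpow (hg0 x).le (hC x) (by linarith)
  have hP := poincare_of_phiSobolev (hΦ.of_le (WithTop.coe_le_coe.2 le_top)) ha ha' hc.le hμ
    (h := fun x => g x ^ (p / 2))
    (hg.rpow_const_of_ne fun x => (hg0 x).ne') ⟨C ^ (p / 2), hbdd⟩
    ⟨p / 2 * ε ^ (p / 2 - 1) * D, fun x => by
      rw [hnorm]
      have h1 := Real.rpow_le_rpow_of_nonpos hε (hεg x) (z := p / 2 - 1) (by linarith)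
      have h2 := hD x
      gcongr⟩
  have hgi : Integrable g μ := .of_bound hgc.aestronglyMeasurable C (ae_of_all _ fun x => by
    rw [Real.norm_of_nonneg (hg0 x).le]; exact hC x)
  have hgpi : Integrable (fun x => g x ^ (p / 2)) μ :=
    .of_bound (hgc.rpow_const fun x => .inl (hg0 x).ne').aestronglyMeasurable _
      (ae_of_all _ hbdd)
  have hJ : ∫ x, g x ^ (p / 2) ∂μ ≤ (∫ x, g x ∂μ) ^ (p / 2) :=
    (Real.concaveOn_rpow (p := p / 2) (by linarith) (by linarith)).le_map_integral
      (Real.continuous_rpow_const (by linarith)).continuousOn isClosed_Ici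
      (ae_of_all _ fun x => (hg0 x).le) hgi hgpi
  have hm0 : 0 ≤ ∫ x, g x ∂μ := integral_nonneg fun x => (hg0 x).le
  have hJ2 : (∫ x, g x ^ (p / 2) ∂μ) ^ 2 ≤ (∫ x, g x ∂μ) ^ p := by
    have h2 : (∫ x, g x ∂μ) ^ p = ((∫ x, g x ∂μ) ^ (p / 2)) ^ 2 := by
      rw [← Real.rpow_mul_natCast hm0]; congr 1; push_cast; ring
    rw [h2]
    exact pow_le_pow_left₀ (integral_nonneg fun x => Real.rpow_nonneg (hg0 x).le _) hJ 2
  have e1 : ∀ x, (g x ^ (p / 2)) ^ 2 = g x ^ p := fun x => by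
    rw [← Real.rpow_mul_natCast (hg0 x).le]; congr 1; push_cast; ring
  have e2 : ∀ x, ‖fderiv ℝ (fun x => g x ^ (p / 2)) x‖ ^ 2 =
      p ^ 2 / 4 * (g x ^ (p - 2) * ‖gradient g x‖ ^ 2) := fun x => by
    rw [hnorm, mul_pow, mul_pow, ← Real.rpow_mul_natCast (hg0 x).le]
    have : (p / 2 - 1) * ((2 : ℕ) : ℝ) = p - 2 := by push_cast; ring
    rw [this]; ring
  simp only [e1, e2, integral_const_mul] at hP
  have e3 : ∀ x, p * (p - 1) * g x ^ (p - 2) * ‖gradient g x‖ ^ 2 =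
      p * (p - 1) * (g x ^ (p - 2) * ‖gradient g x‖ ^ 2) := fun x => by ring
  simp only [e3, integral_const_mul]
  set J := ∫ x, g x ^ (p - 2) * ‖gradient g x‖ ^ 2 ∂μ with hJdef
  have hJ0 : 0 ≤ J := integral_nonneg fun x =>
    mul_nonneg (Real.rpow_nonneg (hg0 x).le _) (sq_nonneg _)
  have e4 : 2 * c * p / (p - 1) * (p * (p - 1) * J) = 2 * c * p ^ 2 * J := by
    have : p - 1 ≠ 0 := by linarith
    field_simp
  have h5 : 0 ≤ c * p ^ 2 * J := by positivity
  rw [e4]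
  linarith
end
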